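/- arXiv:2309.02325 — 3 statements merged into one kernel-verified Lean document; each statement's English description precedes it below -/
import Mathlib

section
/- Suppose there is a constant C > 0 such that for all sufficiently large real x and all natural numbers k with 2^k ≤ 2·log x, the number of primes p ≤ x with ⌈p/2^k⌉ also prime is at most C·x/((log x)²·(log log x)³). Then there is a constant c > 0 such that M(x) − π(x) ≥ c·x/(log x)² for all sufficiently large x. -/
open scoped BigOperators

/-- `M A` is the largest cardinality of a subset of `A` on which the Euler totient
function is nondecreasing. -/
noncomputable def M (A : Set ℕ) : ℕ :=
  sSup {k : ℕ | ∃ B : Finset ℕ, ↑B ⊆ A ∧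
    (∀ m ∈ B, ∀ n ∈ B, m ≤ n → Nat.totient m ≤ Nat.totient n) ∧ B.card = k}

/-- `Mx x = M([x])` where `[x] = {n : ℕ | 1 ≤ n ≤ x}`. -/
noncomputable def Mx (x : ℝ) : ℕ := M {n : ℕ | 1 ≤ n ∧ (n : ℝ) ≤ x}

/-- The number of primes up to the real number `x`. -/
noncomputable def primePi (x : ℝ) : ℕ := {p : ℕ | p.Prime ∧ (p : ℝ) ≤ x}.ncard

section ZetaBounds

open Complex Filter Topology in
theorem norm_ofReal_cpow_neg_sub_le {s : ℂ} (hs : 0 < s.re) {a x : ℝ} (ha : 0 < a) (hx : a ≤ x) :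
    ‖(x : ℂ) ^ (-s) - (a : ℂ) ^ (-s)‖ ≤ ‖s‖ * a ^ (-s.re - 1) * (x - a) := by
  have key := (convex_Icc a x).norm_image_sub_le_of_norm_hasDerivWithin_le
    (f := fun y : ℝ ↦ (y : ℂ) ^ (-s)) (f' := fun y : ℝ ↦ -s * (y : ℂ) ^ (-s - 1))
    (C := ‖s‖ * a ^ (-s.re - 1)) (x := a) (y := x) ?_ ?_ ⟨le_rfl, hx⟩ ⟨hx, le_rfl⟩
  · simpa [Real.norm_eq_abs, abs_of_nonneg (sub_nonneg.2 hx)] using key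
  · intro y hy
    have hy0 : 0 < y := ha.trans_le hy.1
    have hs0 : -s ≠ 0 := by
      intro h
      have := congrArg Complex.re h
      simp at this
      linarith
    exact (hasDerivAt_ofReal_cpow_const' hy0.ne' (r := -s - 1) (by
      intro h; apply hs0; linear_combination h) |>.const_mul (-s) |>.congr_deriv (by simp)
      |>.hasDerivWithinAt).congr (fun z hz ↦ by rw [sub_add_cancel, mul_div_cancel₀ _ hs0])
      (by rw [sub_add_cancel, mul_div_cancel₀ _ hs0])
  · intro y hy
    have hy0 : 0 < y := ha.trans_le hy.1
    rw [norm_mul, norm_neg, norm_cpow_eq_rpow_re_of_pos hy0]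
    simp only [sub_re, neg_re, one_re]
    gcongr ?_ * ?_
    exact Real.rpow_le_rpow_of_nonpos ha hy.1 (by linarith)

/-- The terms of the Dirichlet-type series for `(s - 1) ζ(s) - 1`. -/
noncomputable def zetaTerm (n : ℕ) (s : ℂ) : ℂ :=
  (s - 1) * ((n + 1 : ℝ) : ℂ) ^ (-s) - ((n + 1 : ℝ) : ℂ) ^ (1 - s) + ((n + 2 : ℝ) : ℂ) ^ (1 - s)

theorem norm_zetaTerm_le {s : ℂ} (hs : 0 < s.re) (n : ℕ) :
    ‖zetaTerm n s‖ ≤ ‖s - 1‖ * ‖s‖ * (n + 1 : ℝ) ^ (-s.re - 1) := by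
  have ha : (0 : ℝ) < n + 1 := by positivity
  set a : ℝ := n + 1 with ha_def
  have e : (n + 2 : ℝ) = a + 1 := by rw [ha_def]; ring
  by_cases h1 : s = 1
  · simp [zetaTerm, h1]
  have key := (convex_Icc a (a + 1)).norm_image_sub_le_of_norm_hasDerivWithin_le
    (f := fun y : ℝ ↦ (s - 1) * (a : ℂ) ^ (-s) * y + (y : ℂ) ^ (1 - s))
    (f' := fun y : ℝ ↦ (1 - s) * ((y : ℂ) ^ (-s) - (a : ℂ) ^ (-s)))
    (C := ‖s - 1‖ * (‖s‖ * a ^ (-s.re - 1))) (x := a) (y := a + 1) ?_ ?_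
    ⟨le_rfl, by linarith⟩ ⟨by linarith, le_rfl⟩
  · have e2 : zetaTerm n s = (fun y : ℝ ↦ (s - 1) * (a : ℂ) ^ (-s) * y + (y : ℂ) ^ (1 - s)) (a + 1)
      - (fun y : ℝ ↦ (s - 1) * (a : ℂ) ^ (-s) * y + (y : ℂ) ^ (1 - s)) a := by
      simp only [zetaTerm, e, ← ha_def]
      push_cast
      ring
    rw [e2]
    refine key.trans (le_of_eq ?_)
    simp
    ring
  · intro y hy
    have hy0 : 0 < y := ha.trans_le hy.1
    have h2 : HasDerivAt (fun y : ℝ ↦ (y : ℂ) ^ (1 - s)) ((1 - s) * (y : ℂ) ^ (-s)) y := by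
      have := hasDerivAt_ofReal_cpow_const (x := y) hy0.ne' (r := 1 - s)
        (by intro h; apply h1; linear_combination -h)
      refine this.congr_deriv ?_
      congr 2; ring
    have h3 : HasDerivAt (fun y : ℝ ↦ (s - 1) * (a : ℂ) ^ (-s) * (y : ℂ))
        ((s - 1) * (a : ℂ) ^ (-s)) y := by
      simpa using (Complex.ofRealCLM.hasDerivAt (x := y)).const_mul ((s - 1) * (a : ℂ) ^ (-s))
    exact ((h3.add h2).congr_deriv (by ring)).hasDerivWithinAt
  · intro y hy
    have := norm_ofReal_cpow_neg_sub_le hs ha hy.1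
    rw [norm_mul, norm_sub_rev 1 s]
    gcongr
    refine this.trans ?_
    have h4 : y - a ≤ 1 := by linarith [hy.2]
    have : 0 ≤ ‖s‖ * a ^ (-s.re - 1) := by positivity
    nlinarith

/-- The function `(s - 1) ζ(s)`, given by a series that converges for `0 < re s`. -/
noncomputable def zetaOne (s : ℂ) : ℂ := 1 + ∑' n, zetaTerm n s

theorem summable_rpow_three_halves : Summable fun n : ℕ ↦ (n + 1 : ℝ) ^ (-(3 / 2) : ℝ) := by
  have := (summable_nat_add_iff 1).2 (Real.summable_nat_rpow (p := -(3 / 2)).2 (by norm_num))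
  simpa using this

theorem norm_zetaTerm_le' {s : ℂ} (hs : 1 / 2 < s.re) (n : ℕ) :
    ‖zetaTerm n s‖ ≤ ‖s - 1‖ * ‖s‖ * (n + 1 : ℝ) ^ (-(3 / 2) : ℝ) := by
  refine (norm_zetaTerm_le (by linarith) n).trans ?_
  gcongr
  · linarith [Nat.cast_nonneg (α := ℝ) n]
  · linarith

theorem summable_zetaTerm {s : ℂ} (hs : 1 / 2 < s.re) : Summable fun n ↦ zetaTerm n s :=
  .of_norm_bounded (summable_rpow_three_halves.mul_left _) (norm_zetaTerm_le' hs)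

theorem isOpen_re_gt (a : ℝ) : IsOpen {s : ℂ | a < s.re} :=
  isOpen_lt continuous_const Complex.continuous_re

theorem differentiable_zetaTerm (n : ℕ) : Differentiable ℂ (zetaTerm n) := by
  have h1 : ((n + 1 : ℝ) : ℂ) ≠ 0 := by
    have : (0 : ℝ) < n + 1 := by positivity
    exact_mod_cast this.ne'
  have h2 : ((n + 2 : ℝ) : ℂ) ≠ 0 := by
    have : (0 : ℝ) < n + 2 := by positivity
    exact_mod_cast this.ne'
  intro s
  unfold zetaTerm
  refine .add (.sub (.mul (by fun_prop) ?_) ?_) ?_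
  · exact (differentiableAt_id.neg).const_cpow (.inl h1)
  · exact (differentiableAt_id.const_sub 1).const_cpow (.inl h1)
  · exact (differentiableAt_id.const_sub 1).const_cpow (.inl h2)

theorem differentiableOn_zetaOne : DifferentiableOn ℂ zetaOne {s | 1 / 2 < s.re} := by
  intro s hs
  have hs' : 1 / 2 < s.re := hs
  let U : Set ℂ := {z | 1 / 2 < z.re} ∩ Metric.ball 0 (‖s‖ + 1)
  have hU : IsOpen U := (isOpen_re_gt _).inter Metric.isOpen_ball
  have hsU : s ∈ U := ⟨hs, by simp⟩
  have h := Complex.differentiableOn_tsum_of_summable_norm (F := zetaTerm) (U := U)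
    (u := fun n ↦ (‖s‖ + 2) * (‖s‖ + 1) * (n + 1 : ℝ) ^ (-(3 / 2) : ℝ))
    (summable_rpow_three_halves.mul_left _)
    (fun n ↦ (differentiable_zetaTerm n).differentiableOn) hU ?_
  · exact ((h.differentiableAt (hU.mem_nhds hsU)).const_add 1).differentiableWithinAt
  · intro n z hz
    refine (norm_zetaTerm_le' hz.1 n).trans ?_
    have hz2 : ‖z‖ < ‖s‖ + 1 := by simpa using hz.2
    have hz3 : ‖z - 1‖ ≤ ‖s‖ + 2 := (norm_sub_le z 1).trans (by simp; linarith)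
    gcongr

theorem zetaOne_eq {s : ℂ} (hs : 1 < s.re) : zetaOne s = (s - 1) * riemannZeta s := by
  have h1 := (summable_zetaTerm (s := s) (by linarith)).hasSum.tendsto_sum_nat
  have e : ∀ N : ℕ, ∑ n ∈ Finset.range N, zetaTerm n s =
      (s - 1) * ∑ n ∈ Finset.range N, 1 / ((n : ℂ) + 1) ^ s + (((N + 1 : ℝ) : ℂ) ^ (1 - s) - 1) := by
    intro N
    induction N with
    | zero => simp
    | succ N ih =>
      rw [Finset.sum_range_succ, Finset.sum_range_succ, ih, zetaTerm, Complex.cpow_neg]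
      push_cast
      rw [show ((N : ℂ) + 1 + 1) = N + 2 by ring]
      ring
  have hsum : Summable fun n : ℕ ↦ 1 / ((n : ℂ) + 1) ^ s := by
    have := (summable_nat_add_iff 1).2 (Complex.summable_one_div_nat_cpow.2 hs)
    simpa using this
  have h2 : Filter.Tendsto (fun N : ℕ ↦ (((N + 1 : ℝ) : ℂ) ^ (1 - s))) Filter.atTop (nhds 0) := by
    rw [tendsto_zero_iff_norm_tendsto_zero]
    have h3 : Filter.Tendsto (fun N : ℕ ↦ ((N : ℝ) + 1) ^ (-(s.re - 1))) Filter.atTop (nhds 0) :=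
      (tendsto_rpow_neg_atTop (by linarith)).comp
        (Filter.tendsto_atTop_add_const_right _ _ tendsto_natCast_atTop_atTop)
    refine h3.congr fun N ↦ ?_
    rw [Complex.norm_cpow_eq_rpow_re_of_pos (by positivity)]
    simp
  have h4 := (hsum.hasSum.tendsto_sum_nat.const_mul (s - 1)).add (h2.sub_const 1)
  simp_rw [← e] at h4
  have := tendsto_nhds_unique h1 h4
  rw [zetaOne, this, zeta_eq_tsum_one_div_nat_add_one_cpow hs]
  ring

/-- `f` grows at most polynomially on `S`. -/
def PolyBdd (S : Set ℂ) (f : ℂ → ℂ) : Prop :=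
  ∃ (C : ℝ) (N : ℕ), 1 ≤ C ∧ ∀ s ∈ S, ‖f s‖ ≤ C * (1 + ‖s‖) ^ N

namespace PolyBdd

variable {S T : Set ℂ} {f g : ℂ → ℂ}

theorem mono (hf : PolyBdd S f) (h : T ⊆ S) : PolyBdd T f := by
  obtain ⟨C, N, hC, hf⟩ := hf
  exact ⟨C, N, hC, fun s hs ↦ hf s (h hs)⟩

theorem congr (hf : PolyBdd S f) (h : ∀ s ∈ S, g s = f s) : PolyBdd S g := by
  obtain ⟨C, N, hC, hf⟩ := hf
  exact ⟨C, N, hC, fun s hs ↦ by rw [h s hs]; exact hf s hs⟩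

theorem neg (hf : PolyBdd S f) : PolyBdd S (fun s ↦ -f s) := by
  obtain ⟨C, N, hC, hf⟩ := hf
  exact ⟨C, N, hC, fun s hs ↦ by rw [norm_neg]; exact hf s hs⟩

theorem mul (hf : PolyBdd S f) (hg : PolyBdd S g) : PolyBdd S (fun s ↦ f s * g s) := by
  obtain ⟨C, N, hC, hf⟩ := hf
  obtain ⟨D, M, hD, hg⟩ := hg
  refine ⟨C * D, N + M, by nlinarith, fun s hs ↦ ?_⟩
  rw [norm_mul, pow_add, mul_mul_mul_comm]
  exact mul_le_mul (hf s hs) (hg s hs) (norm_nonneg _) (by positivity)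

theorem add (hf : PolyBdd S f) (hg : PolyBdd S g) : PolyBdd S (fun s ↦ f s + g s) := by
  obtain ⟨C, N, hC, hf⟩ := hf
  obtain ⟨D, M, hD, hg⟩ := hg
  refine ⟨C + D, N + M, by linarith, fun s hs ↦ (norm_add_le _ _).trans ?_⟩
  have h1 : 1 ≤ 1 + ‖s‖ := by linarith [norm_nonneg s]
  have h2 : (1 + ‖s‖) ^ N ≤ (1 + ‖s‖) ^ (N + M) := pow_le_pow_right₀ h1 (by omega)
  have h3 : (1 + ‖s‖) ^ M ≤ (1 + ‖s‖) ^ (N + M) := pow_le_pow_right₀ h1 (by omega)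
  have h4 := (hf s hs).trans (mul_le_mul_of_nonneg_left h2 (by linarith))
  have h5 := (hg s hs).trans (mul_le_mul_of_nonneg_left h3 (by linarith))
  linarith

theorem sub (hf : PolyBdd S f) (hg : PolyBdd S g) : PolyBdd S (fun s ↦ f s - g s) :=
  (hf.add hg.neg).congr fun _ _ ↦ sub_eq_add_neg _ _

theorem union (hf : PolyBdd S f) (hg : PolyBdd T f) : PolyBdd (S ∪ T) f := by
  obtain ⟨C, N, hC, hf⟩ := hf
  obtain ⟨D, M, hD, hg⟩ := hg
  refine ⟨C + D, N + M, by linarith, fun s hs ↦ ?_⟩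
  have h1 : 1 ≤ 1 + ‖s‖ := by linarith [norm_nonneg s]
  have h2 : (1 + ‖s‖) ^ N ≤ (1 + ‖s‖) ^ (N + M) := pow_le_pow_right₀ h1 (by omega)
  have h3 : (1 + ‖s‖) ^ M ≤ (1 + ‖s‖) ^ (N + M) := pow_le_pow_right₀ h1 (by omega)
  rcases hs with hs | hs
  · exact (hf s hs).trans (mul_le_mul (by linarith) h2 (by positivity) (by linarith))
  · exact (hg s hs).trans (mul_le_mul (by linarith) h3 (by positivity) (by linarith))

theorem of_isCompact (hS : IsCompact S) (hf : ContinuousOn f S) : PolyBdd S f := by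
  obtain ⟨C, hC⟩ := hS.exists_bound_of_continuousOn hf
  exact ⟨max C 1, 0, le_max_right _ _, fun s hs ↦ by simpa using .inl (hC s hs)⟩

theorem deriv {a b : ℝ} (hab : a < b) (hf : PolyBdd {s | a < s.re} f)
    (hd : DifferentiableOn ℂ f {s | a < s.re}) : PolyBdd {s | b < s.re} (deriv f) := by
  obtain ⟨C, N, hC, hf⟩ := hf
  set r := (b - a) / 2 with hr
  have hr0 : 0 < r := by linarith
  refine ⟨C * (1 + r) ^ N / r + 1, N, by
    have : 0 ≤ C * (1 + r) ^ N / r := by positivity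
    linarith, fun s hs ↦ ?_⟩
  have hs' : b < s.re := hs
  have hsub : Metric.closedBall s r ⊆ {s | a < s.re} := by
    intro z hz
    have h1 : ‖z - s‖ ≤ r := by simpa [dist_eq_norm] using hz
    have h2 := (abs_le.1 ((Complex.abs_re_le_norm (z - s)).trans h1)).1
    simp only [Complex.sub_re] at h2
    show a < z.re
    linarith
  have hdc : DiffContOnCl ℂ f (Metric.ball s r) :=
    ((hd.mono hsub).mono Metric.closure_ball_subset_closedBall).diffContOnCl
  have := Complex.norm_deriv_le_of_forall_mem_sphere_norm_le hr0 hdc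
    (C := C * ((1 + r) * (1 + ‖s‖)) ^ N) fun z hz ↦ by
      refine (hf z (hsub (Metric.sphere_subset_closedBall hz))).trans ?_
      have h1 : ‖z - s‖ = r := by simpa [dist_eq_norm] using hz
      have h2 : ‖z‖ ≤ ‖s‖ + r := by
        have := norm_add_le s (z - s)
        rw [add_sub_cancel, h1] at this
        exact this
      have h3 : 1 + ‖z‖ ≤ (1 + r) * (1 + ‖s‖) := by nlinarith [norm_nonneg s]
      gcongr
  refine this.trans ?_
  rw [mul_pow, ← mul_assoc, mul_div_right_comm]
  gcongr
  linarith

end PolyBdd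

theorem polyBdd_const (S : Set ℂ) (c : ℂ) : PolyBdd S (fun _ ↦ c) :=
  ⟨max ‖c‖ 1, 0, le_max_right _ _, fun s _ ↦ by simp⟩

theorem polyBdd_zetaOne : PolyBdd {s | 1 / 2 < s.re} zetaOne := by
  set A := ∑' n : ℕ, (n + 1 : ℝ) ^ (-(3 / 2) : ℝ) with hA
  have hA0 : 0 ≤ A := tsum_nonneg fun n ↦ by positivity
  refine ⟨1 + A, 2, by linarith, fun s hs ↦ ?_⟩
  have hb := tsum_of_norm_bounded
    ((summable_rpow_three_halves.mul_left (‖s - 1‖ * ‖s‖)).hasSum) (norm_zetaTerm_le' hs)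
  rw [tsum_mul_left, ← hA] at hb
  have h1 : ‖s - 1‖ ≤ 1 + ‖s‖ := (norm_sub_le s 1).trans (by simp [add_comm])
  have h2 : ‖s - 1‖ * ‖s‖ ≤ (1 + ‖s‖) ^ 2 := by
    nlinarith [norm_nonneg s, norm_nonneg (s - 1)]
  have h3 : ‖zetaOne s‖ ≤ 1 + ‖s - 1‖ * ‖s‖ * A := by
    refine (norm_add_le _ _).trans ?_
    rw [norm_one]
    linarith
  have h4 : 1 ≤ (1 + ‖s‖) ^ 2 := by nlinarith [norm_nonneg s]
  nlinarith [mul_le_mul_of_nonneg_right h2 hA0]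

theorem differentiableAt_zetaOne {s : ℂ} (hs : 1 / 2 < s.re) : DifferentiableAt ℂ zetaOne s :=
  differentiableOn_zetaOne.differentiableAt ((isOpen_re_gt _).mem_nhds hs)

theorem zetaOne_one : zetaOne 1 = 1 := by
  simp [zetaOne, zetaTerm]

theorem zetaOne_eq_of_one_le_re {s : ℂ} (hs : 1 ≤ s.re) (h1 : s ≠ 1) :
    zetaOne s = (s - 1) * riemannZeta s := by
  have hc : Filter.Tendsto (fun ε : ℝ ↦ s + ε) (nhdsWithin 0 (Set.Ioi 0)) (nhds s) := by
    have : Continuous fun ε : ℝ ↦ s + ε := by fun_prop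
    have := this.tendsto 0
    simp only [Complex.ofReal_zero, add_zero] at this
    exact this.mono_left nhdsWithin_le_nhds
  have hl := (differentiableAt_zetaOne (s := s) (by linarith)).continuousAt.tendsto.comp hc
  have hr := ((((continuous_id.sub continuous_const).continuousAt (x := s)).mul
    (differentiableAt_riemannZeta h1).continuousAt).tendsto.comp hc :
      Filter.Tendsto _ _ (nhds ((s - 1) * riemannZeta s)))
  refine tendsto_nhds_unique_of_eventuallyEq hl hr ?_
  filter_upwards [self_mem_nhdsWithin] with ε hε
  have hε' : (0 : ℝ) < ε := hε
  exact zetaOne_eq (by simp; linarith)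

theorem zetaOne_ne_zero {s : ℂ} (hs : 1 ≤ s.re) : zetaOne s ≠ 0 := by
  by_cases h1 : s = 1
  · simp [h1, zetaOne_one]
  · rw [zetaOne_eq_of_one_le_re hs h1]
    exact mul_ne_zero (sub_ne_zero.2 h1) (riemannZeta_ne_zero_of_one_le_re hs)

theorem one_le_norm_riemannZeta_product {x : ℝ} (hx : 0 < x) (y : ℝ) :
    1 ≤ ‖riemannZeta (1 + x)‖ ^ 3 * ‖riemannZeta (1 + x + Complex.I * y)‖ ^ 4 *
      ‖riemannZeta (1 + x + 2 * Complex.I * y)‖ := by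
  have := DirichletCharacter.norm_LFunction_product_ge_one (1 : DirichletCharacter ℂ 1) hx y
  simpa [DirichletCharacter.LFunctionTrivChar, DirichletCharacter.LFunction_modOne_eq] using this

theorem exists_pow_le_norm_zetaOne : ∃ (C : ℝ) (N : ℕ), 1 ≤ C ∧
    ∀ s : ℂ, 1 < s.re → s.re ≤ 2 → 1 ≤ |s.im| →
      (s.re - 1) ^ 3 ≤ C * (1 + ‖s‖) ^ N * ‖zetaOne s‖ ^ 4 := by
  obtain ⟨C, N, hC, hZ⟩ := polyBdd_zetaOne
  refine ⟨(C * 3 ^ N) ^ 3 * (C * 2 ^ N), N, ?_, fun s hs hs2 him ↦ ?_⟩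
  · have h3 : (1 : ℝ) ≤ 3 ^ N := one_le_pow₀ (by norm_num)
    have h2 : (1 : ℝ) ≤ 2 ^ N := one_le_pow₀ (by norm_num)
    exact one_le_mul_of_one_le_of_one_le (one_le_pow₀ (one_le_mul_of_one_le_of_one_le hC h3))
      (one_le_mul_of_one_le_of_one_le hC h2)
  set x := s.re - 1 with hx
  have hx0 : 0 < x := by linarith
  have key := one_le_norm_riemannZeta_product hx0 s.im
  have es : (1 : ℂ) + x + Complex.I * s.im = s := by
    apply Complex.ext <;> simp [hx]
  rw [es] at key
  have e1 : ‖riemannZeta (1 + x)‖ * x ≤ C * 3 ^ N := by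
    have h1 := zetaOne_eq (s := 1 + x) (by simp; linarith)
    have h2 := hZ (1 + x) (by simp; linarith)
    rw [h1, norm_mul] at h2
    have h3 : ‖(1 + x : ℂ) - 1‖ = x := by simp [abs_of_pos hx0]
    have h4 : ‖(1 + x : ℂ)‖ ≤ 2 := by
      have : (1 + x : ℂ) = ((1 + x : ℝ) : ℂ) := by push_cast; rfl
      rw [this, Complex.norm_real, Real.norm_eq_abs, abs_of_pos (by linarith)]
      linarith
    rw [h3, mul_comm] at h2
    refine h2.trans ?_
    gcongr
    linarith
  have e2 : ‖riemannZeta s‖ ≤ ‖zetaOne s‖ := by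
    rw [zetaOne_eq hs, norm_mul]
    have : 1 ≤ ‖s - 1‖ := him.trans (by simpa using Complex.abs_im_le_norm (s - 1))
    nlinarith [norm_nonneg (riemannZeta s)]
  have e3 : ‖riemannZeta (1 + x + 2 * Complex.I * s.im)‖ ≤ C * 2 ^ N * (1 + ‖s‖) ^ N := by
    set z : ℂ := 1 + x + 2 * Complex.I * s.im with hz
    have hzre : z.re = 1 + x := by simp [hz]
    have hzim : z.im = 2 * s.im := by simp [hz]
    have h1 := zetaOne_eq (s := z) (by rw [hzre]; linarith)
    have h2 := hZ z (by show _ < z.re; rw [hzre]; linarith)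
    rw [h1, norm_mul] at h2
    have h3 : 1 ≤ ‖z - 1‖ := by
      refine le_trans ?_ (Complex.abs_im_le_norm (z - 1))
      simp only [Complex.sub_im, Complex.one_im, sub_zero, hzim, abs_mul]
      norm_num
      linarith
    have h4 : ‖z‖ ≤ 2 * ‖s‖ := by
      have : z = 2 * s - (s.re : ℂ) := by
        apply Complex.ext <;> simp [hzre, hzim, hx]
        ring
      have h5 : ‖z‖ ^ 2 ≤ (2 * ‖s‖) ^ 2 := by
        rw [mul_pow, Complex.sq_norm, Complex.sq_norm, Complex.normSq_apply, Complex.normSq_apply,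
          hzre, hzim]
        have : 1 + x = s.re := by rw [hx]; ring
        rw [this]
        nlinarith [sq_nonneg s.re]
      exact le_of_sq_le_sq h5 (by positivity)
    calc ‖riemannZeta z‖ ≤ ‖z - 1‖ * ‖riemannZeta z‖ := by
          nlinarith [norm_nonneg (riemannZeta z)]
      _ ≤ C * (1 + ‖z‖) ^ N := h2
      _ ≤ C * (2 * (1 + ‖s‖)) ^ N := by gcongr; linarith
      _ = _ := by rw [mul_pow]; ring
  calc x ^ 3 ≤ x ^ 3 * (‖riemannZeta (1 + x)‖ ^ 3 * ‖riemannZeta s‖ ^ 4 *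
      ‖riemannZeta (1 + x + 2 * Complex.I * s.im)‖) := by
        exact le_mul_of_one_le_right (by positivity) key
    _ = (‖riemannZeta (1 + x)‖ * x) ^ 3 * ‖riemannZeta s‖ ^ 4 *
      ‖riemannZeta (1 + x + 2 * Complex.I * s.im)‖ := by ring
    _ ≤ (C * 3 ^ N) ^ 3 * ‖zetaOne s‖ ^ 4 * (C * 2 ^ N * (1 + ‖s‖) ^ N) := by gcongr
    _ = _ := by ring

theorem polyBdd_deriv_zetaOne : PolyBdd {s | 3 / 4 < s.re} (deriv zetaOne) :=
  polyBdd_zetaOne.deriv (by norm_num) differentiableOn_zetaOne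

theorem exists_le_norm_zetaOne_of_one_le_im : ∃ (E : ℝ) (P : ℕ), 1 ≤ E ∧
    ∀ s : ℂ, 1 ≤ s.re → s.re ≤ 2 → 1 ≤ |s.im| → 1 ≤ E * (1 + ‖s‖) ^ P * ‖zetaOne s‖ := by
  obtain ⟨C, N, hC, hlow⟩ := exists_pow_le_norm_zetaOne
  obtain ⟨D, M, hD, hder⟩ := polyBdd_deriv_zetaOne
  set D' := D * 2 ^ M with hD'
  have hD'1 : 1 ≤ D' := one_le_mul_of_one_le_of_one_le hD (one_le_pow₀ (by norm_num))
  have hDp : 1 ≤ D' ^ 4 := one_le_pow₀ hD'1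
  have h2N : (1 : ℝ) ≤ 2 ^ N := one_le_pow₀ (by norm_num)
  have hC2 : C ≤ C * 2 ^ N := le_mul_of_one_le_right (by linarith) h2N
  have hE0 : C * 2 ^ N ≤ 16 * D' ^ 4 * (C * 2 ^ N) := by
    apply le_mul_of_one_le_left (by positivity)
    linarith
  refine ⟨16 * D' ^ 4 * (C * 2 ^ N), 4 * M + N, by linarith, fun s hs hs2 him ↦ ?_⟩
  set E := 16 * D' ^ 4 * (C * 2 ^ N) with hE
  set W := 1 + ‖s‖ with hW
  have hW1 : 1 ≤ W := by linarith [norm_nonneg s]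
  have hWM : 1 ≤ W ^ M := one_le_pow₀ hW1
  have hEP : C * W ^ N ≤ E * W ^ (4 * M + N) := by
    have : W ^ N ≤ W ^ (4 * M + N) := pow_le_pow_right₀ hW1 (by omega)
    exact mul_le_mul (by linarith) this (by positivity) (by linarith)
  have hEP1 : 1 ≤ E * W ^ (4 * M + N) :=
    one_le_mul_of_one_le_of_one_le (by linarith) (one_le_pow₀ hW1)
  set η := (E * W ^ (4 * M + N))⁻¹ with hη
  have hη0 : 0 < η := by positivity
  have hη1 : η ≤ 1 := inv_le_one_of_one_le₀ hEP1
  suffices h : η ≤ ‖zetaOne s‖ by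
    have := mul_le_mul_of_nonneg_left h (by linarith : 0 ≤ E * W ^ (4 * M + N))
    rwa [hη, mul_inv_cancel₀ (by linarith)] at this
  by_cases hc : 1 + η ≤ s.re
  · have h1 := hlow s (by linarith) hs2 him
    have h2 : η ^ 3 ≤ (s.re - 1) ^ 3 := by gcongr; linarith
    have h3 : η ^ 4 ≤ ‖zetaOne s‖ ^ 4 := by
      calc η ^ 4 = η * η ^ 3 := by ring
        _ ≤ η * (C * W ^ N * ‖zetaOne s‖ ^ 4) := by gcongr; linarith
        _ ≤ η * (E * W ^ (4 * M + N) * ‖zetaOne s‖ ^ 4) := by gcongr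
        _ = ‖zetaOne s‖ ^ 4 := by rw [← mul_assoc, hη, inv_mul_cancel₀ (by linarith), one_mul]
    exact le_of_pow_le_pow_left₀ (by norm_num) (norm_nonneg _) h3
  · push Not at hc
    set s' : ℂ := ⟨1 + η, s.im⟩ with hs'
    have hd : ‖s' - s‖ ≤ η := by
      have : s' - s = ((1 + η - s.re : ℝ) : ℂ) := by apply Complex.ext <;> simp [hs']
      rw [this, Complex.norm_real, Real.norm_eq_abs, abs_of_nonneg (by linarith)]
      linarith
    have hball : ∀ z ∈ Metric.closedBall s 1, ‖z‖ ≤ ‖s‖ + 1 := by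
      intro z hz
      have h1 : ‖z - s‖ ≤ 1 := by simpa [dist_eq_norm] using hz
      have := norm_add_le s (z - s)
      rw [add_sub_cancel] at this
      linarith
    have hs'b : s' ∈ Metric.closedBall s 1 := by
      simpa [dist_eq_norm] using hd.trans hη1
    have hconv : Convex ℝ (Metric.closedBall s 1 ∩ {z : ℂ | 3 / 4 < z.re}) :=
      (convex_closedBall s 1).inter (convex_halfSpace_re_gt _)
    have h1 := hconv.norm_image_sub_le_of_norm_deriv_le (f := zetaOne) (C := D' * W ^ M)
      (x := s) (y := s') (fun z hz ↦ differentiableAt_zetaOne (by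
        have : 3 / 4 < z.re := hz.2
        linarith)) (fun z hz ↦ by
        refine (hder z hz.2).trans ?_
        have := hball z hz.1
        rw [hD', mul_assoc, ← mul_pow]
        gcongr
        linarith) ⟨by simp, by show _ < s.re; linarith⟩ ⟨hs'b, by show (3 / 4 : ℝ) < 1 + η; linarith⟩
    have h2 := hlow s' (by show 1 < 1 + η; linarith) (by show 1 + η ≤ 2; linarith) him
    have h3 : (s'.re - 1) = η := by simp [hs']
    rw [h3] at h2
    have h4 : 1 + ‖s'‖ ≤ 2 * W := by linarith [hball s' hs'b]
    have h5 : η ^ 3 ≤ C * 2 ^ N * W ^ N * ‖zetaOne s'‖ ^ 4 := by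
      refine h2.trans ?_
      rw [mul_assoc C (2 ^ N), ← mul_pow]
      gcongr
    set a := D' * W ^ M * η with ha
    have h6 : 2 * a ≤ ‖zetaOne s'‖ := by
      have h7 : (2 * a) ^ 4 * (C * 2 ^ N * W ^ N) = η ^ 3 := by
        have : (2 * a) ^ 4 * (C * 2 ^ N * W ^ N) = η ^ 3 * (η * (E * W ^ (4 * M + N))) := by
          rw [ha, hE]; ring
        rw [this, hη, inv_mul_cancel₀ (by linarith), mul_one]
      have hpos : 0 < C * 2 ^ N * W ^ N := by positivity
      have h8 : (2 * a) ^ 4 ≤ ‖zetaOne s'‖ ^ 4 := by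
        refine le_of_mul_le_mul_right ?_ hpos
        rw [h7]
        linarith
      exact le_of_pow_le_pow_left₀ (by norm_num) (norm_nonneg _) h8
    have h9 : ‖zetaOne s' - zetaOne s‖ ≤ a := h1.trans (by rw [ha]; gcongr)
    have h10 := norm_sub_norm_le (zetaOne s') (zetaOne s)
    have h11 : η ≤ a := by
      rw [ha]
      exact le_mul_of_one_le_left hη0.le (one_le_mul_of_one_le_of_one_le hD'1 hWM)
    linarith

theorem polyBdd_inv_zetaOne : PolyBdd {s | 1 ≤ s.re ∧ s.re ≤ 2} (fun s ↦ (zetaOne s)⁻¹) := by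
  obtain ⟨E, P, hE, h⟩ := exists_le_norm_zetaOne_of_one_le_im
  have h1 : PolyBdd {s | 1 ≤ s.re ∧ s.re ≤ 2 ∧ 1 ≤ |s.im|} (fun s ↦ (zetaOne s)⁻¹) := by
    refine ⟨E, P, hE, fun s hs ↦ ?_⟩
    have hpos : 0 < ‖zetaOne s‖ := norm_pos_iff.2 (zetaOne_ne_zero hs.1)
    rw [norm_inv, inv_eq_one_div, div_le_iff₀ hpos]
    exact h s hs.1 hs.2.1 hs.2.2
  have h2 : PolyBdd (Set.Icc (1 : ℝ) 2 ×ℂ Set.Icc (-1 : ℝ) 1) (fun s ↦ (zetaOne s)⁻¹) := by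
    refine PolyBdd.of_isCompact (isCompact_Icc.reProdIm isCompact_Icc) fun s hs ↦ ?_
    have hs1 : 1 ≤ s.re := (Complex.mem_reProdIm.1 hs).1.1
    exact ((differentiableAt_zetaOne (by linarith)).continuousAt.inv₀
      (zetaOne_ne_zero hs1)).continuousWithinAt
  refine (h1.union h2).mono fun s hs ↦ ?_
  by_cases hi : 1 ≤ |s.im|
  · exact .inl ⟨hs.1, hs.2, hi⟩
  · push Not at hi
    exact .inr (Complex.mem_reProdIm.2 ⟨hs, abs_le.1 hi.le⟩)

/-- The analytic continuation of `-deriv ζ / ζ - ζ`, regular on the line `re s = 1`. -/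
noncomputable def logDerivError (s : ℂ) : ℂ :=
  -(deriv zetaOne s * (zetaOne s)⁻¹) - dslope zetaOne 1 s

theorem differentiableOn_dslope_zetaOne :
    DifferentiableOn ℂ (dslope zetaOne 1) {s | 1 / 2 < s.re} :=
  (Complex.differentiableOn_dslope ((isOpen_re_gt _).mem_nhds (by
    show (1 / 2 : ℝ) < (1 : ℂ).re
    norm_num))).2 differentiableOn_zetaOne

theorem differentiableOn_deriv_zetaOne :
    DifferentiableOn ℂ (deriv zetaOne) {s | 1 / 2 < s.re} :=
  differentiableOn_zetaOne.deriv (isOpen_re_gt _)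

theorem polyBdd_dslope_zetaOne : PolyBdd {s | 1 / 2 < s.re} (dslope zetaOne 1) := by
  have hcl : Metric.closedBall (1 : ℂ) (1 / 4) ⊆ {s | 1 / 2 < s.re} := by
    intro z hz
    have h1 : ‖z - 1‖ ≤ 1 / 4 := by simpa [dist_eq_norm] using hz
    have h2 := (abs_le.1 ((Complex.abs_re_le_norm (z - 1)).trans h1)).1
    simp only [Complex.sub_re, Complex.one_re] at h2
    show 1 / 2 < z.re
    linarith
  have h1 : PolyBdd (Metric.closedBall (1 : ℂ) (1 / 4)) (dslope zetaOne 1) :=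
    .of_isCompact (isCompact_closedBall _ _) (differentiableOn_dslope_zetaOne.mono hcl).continuousOn
  have h2 : PolyBdd ({s | 1 / 2 < s.re} \ Metric.closedBall (1 : ℂ) (1 / 4))
      (dslope zetaOne 1) := by
    have h3 : PolyBdd ({s | 1 / 2 < s.re} \ Metric.closedBall (1 : ℂ) (1 / 4))
        (fun s ↦ (s - 1)⁻¹) := by
      refine ⟨4, 0, by norm_num, fun s hs ↦ ?_⟩
      have : 1 / 4 < ‖s - 1‖ := by simpa [dist_eq_norm] using hs.2
      rw [norm_inv, pow_zero, mul_one]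
      exact inv_le_of_inv_le₀ (by norm_num) (by linarith)
    refine (h3.mul ((polyBdd_zetaOne.mono Set.sdiff_subset).sub (polyBdd_const _ 1))).congr
      fun s hs ↦ ?_
    have hs1 : s ≠ 1 := by
      rintro rfl
      simp at hs
    rw [dslope_of_ne _ hs1, slope_def_module, zetaOne_one, smul_eq_mul]
  exact (h1.union h2).mono fun s hs ↦ by
    by_cases h : s ∈ Metric.closedBall (1 : ℂ) (1 / 4)
    · exact .inl h
    · exact .inr ⟨hs, h⟩

theorem hasDerivAt_logDerivError {s : ℂ} (hs : 1 ≤ s.re) :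
    HasDerivAt logDerivError
      (-(deriv (deriv zetaOne) s * (zetaOne s)⁻¹ +
        deriv zetaOne s * (-deriv zetaOne s * ((zetaOne s)⁻¹ * (zetaOne s)⁻¹)))
        - deriv (dslope zetaOne 1) s) s := by
  have hn : {s : ℂ | 1 / 2 < s.re} ∈ nhds s := (isOpen_re_gt _).mem_nhds (by
    show 1 / 2 < s.re
    linarith)
  have h1 := (differentiableOn_zetaOne.differentiableAt hn).hasDerivAt
  have h2 := (differentiableOn_deriv_zetaOne.differentiableAt hn).hasDerivAt
  have h3 := (differentiableOn_dslope_zetaOne.differentiableAt hn).hasDerivAt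
  have h4 := h1.inv (zetaOne_ne_zero hs)
  refine ((h2.mul (h4.congr_deriv ?_)).neg.sub h3)
  field_simp

theorem strip_subset {a : ℝ} (ha : a < 1) : {s : ℂ | 1 ≤ s.re ∧ s.re ≤ 2} ⊆ {s | a < s.re} :=
  fun _ hs ↦ lt_of_lt_of_le ha hs.1

theorem polyBdd_logDerivError : PolyBdd {s | 1 ≤ s.re ∧ s.re ≤ 2} logDerivError :=
  ((polyBdd_deriv_zetaOne.mono (strip_subset (by norm_num))).mul polyBdd_inv_zetaOne).neg.sub
    (polyBdd_dslope_zetaOne.mono (strip_subset (by norm_num)))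

theorem polyBdd_deriv_logDerivError :
    PolyBdd {s | 1 ≤ s.re ∧ s.re ≤ 2} (deriv logDerivError) := by
  have h1 := polyBdd_deriv_zetaOne.mono (strip_subset (by norm_num))
  have h2 : PolyBdd {s | 1 ≤ s.re ∧ s.re ≤ 2} (deriv (deriv zetaOne)) :=
    (polyBdd_deriv_zetaOne.deriv (b := 7 / 8) (by norm_num)
      (differentiableOn_deriv_zetaOne.mono fun s hs ↦ by
        have : 3 / 4 < s.re := hs
        show 1 / 2 < s.re
        linarith)).mono (strip_subset (by norm_num))
  have h3 : PolyBdd {s | 1 ≤ s.re ∧ s.re ≤ 2} (deriv (dslope zetaOne 1)) :=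
    (polyBdd_dslope_zetaOne.deriv (b := 3 / 4) (by norm_num)
      differentiableOn_dslope_zetaOne).mono (strip_subset (by norm_num))
  refine (((h2.mul polyBdd_inv_zetaOne).add
    (h1.mul (h1.neg.mul (polyBdd_inv_zetaOne.mul polyBdd_inv_zetaOne)))).neg.sub h3).congr
      fun s hs ↦ ?_
  rw [(hasDerivAt_logDerivError hs.1).deriv]

open ArithmeticFunction in
theorem lSeriesHasSum_vonMangoldt_sub_one {s : ℂ} (hs : 1 < s.re) :
    LSeriesHasSum (fun n ↦ ((vonMangoldt n : ℝ) : ℂ) - 1) s (logDerivError s) := by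
  have h1 := (LSeriesSummable_vonMangoldt hs).LSeriesHasSum
  rw [LSeries_vonMangoldt_eq_deriv_riemannZeta_div hs] at h1
  have h2 := (LSeriesSummable_one_iff.2 hs).LSeriesHasSum
  rw [LSeries_one_eq_riemannZeta hs] at h2
  have h3 := h1.sub h2
  have hs1 : s ≠ 1 := by rintro rfl; simp at hs
  have hs0 : s - 1 ≠ 0 := sub_ne_zero.2 hs1
  have hz : riemannZeta s ≠ 0 := riemannZeta_ne_zero_of_one_le_re hs.le
  have hd : deriv zetaOne s = riemannZeta s + (s - 1) * deriv riemannZeta s := by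
    have he : zetaOne =ᶠ[nhds s] fun z ↦ (z - 1) * riemannZeta z := by
      filter_upwards [(isOpen_re_gt 1).mem_nhds hs] with z hz
      exact zetaOne_eq hz
    rw [he.deriv_eq]
    have h4 : HasDerivAt (fun z ↦ (z - 1) * riemannZeta z)
        (1 * riemannZeta s + (s - 1) * deriv riemannZeta s) s :=
      ((hasDerivAt_id s).sub_const 1).mul (differentiableAt_riemannZeta hs1).hasDerivAt
    rw [h4.deriv, one_mul]
  have e : logDerivError s = -deriv riemannZeta s / riemannZeta s - riemannZeta s := by
    rw [logDerivError, hd, dslope_of_ne _ hs1, slope_def_module, zetaOne_one, smul_eq_mul,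
      zetaOne_eq hs]
    field_simp
    ring
  rw [e]
  exact h3

end ZetaBounds

section RieszKernel

/-- The Riesz weight `(1 - u)₊ ^ m`. -/
noncomputable def riesz (m : ℕ) (u : ℝ) : ℝ := max (1 - u) 0 ^ m

theorem riesz_nonneg (m : ℕ) (u : ℝ) : 0 ≤ riesz m u := pow_nonneg (le_max_right _ _) _

theorem riesz_le_one (m : ℕ) {u : ℝ} (hu : 0 ≤ u) : riesz m u ≤ 1 :=
  pow_le_one₀ (le_max_right _ _) (max_le (by linarith) zero_le_one)

theorem riesz_of_one_le {m : ℕ} (hm : m ≠ 0) {u : ℝ} (hu : 1 ≤ u) : riesz m u = 0 := by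
  rw [riesz, max_eq_right (by linarith), zero_pow hm]

theorem riesz_of_le_one (m : ℕ) {u : ℝ} (hu : u ≤ 1) : riesz m u = (1 - u) ^ m := by
  rw [riesz, max_eq_left (by linarith)]

theorem riesz_antitone (m : ℕ) : Antitone (riesz m) := fun a b hab ↦
  pow_le_pow_left₀ (le_max_right _ _) (max_le_max_right _ (by linarith)) _

theorem continuous_riesz (m : ℕ) : Continuous (riesz m) := by
  unfold riesz
  fun_prop

/-- The Mellin transform of the Riesz weight. -/
noncomputable def rieszMellin (m : ℕ) (s : ℂ) : ℂ :=
  (m.factorial : ℂ) / ∏ j ∈ Finset.range (m + 1), (s + j)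

open MeasureTheory Set in
theorem mellinConvergent_riesz {m : ℕ} (hm : m ≠ 0) {s : ℂ} (hs : 0 < s.re) :
    MellinConvergent (fun u ↦ (riesz m u : ℂ)) s := by
  have h1 := Complex.betaIntegral_convergent (v := (m : ℂ) + 1) hs (by
    simp only [Complex.add_re, Complex.natCast_re, Complex.one_re]
    positivity)
  rw [intervalIntegrable_iff_integrableOn_Ioc_of_le zero_le_one] at h1
  have h2 : IntegrableOn (fun t : ℝ ↦ (t : ℂ) ^ (s - 1) • (riesz m t : ℂ)) (Ioc 0 1) := by
    refine h1.congr_fun (fun t ht ↦ ?_) measurableSet_Ioc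
    simp [riesz_of_le_one m ht.2]
  refine h2.of_forall_sdiff_eq_zero measurableSet_Ioi fun t ht ↦ ?_
  have : 1 ≤ t := by
    by_contra! h
    exact ht.2 ⟨ht.1, h.le⟩
  simp [riesz_of_one_le hm this]

open MeasureTheory Set in
theorem mellin_riesz {m : ℕ} (hm : m ≠ 0) {s : ℂ} (hs : 0 < s.re) :
    mellin (fun u ↦ (riesz m u : ℂ)) s = rieszMellin m s := by
  rw [rieszMellin, ← Complex.betaIntegral_eval_nat_add_one_right hs, Complex.betaIntegral, mellin,
    intervalIntegral.integral_of_le zero_le_one]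
  rw [setIntegral_eq_of_subset_of_forall_sdiff_eq_zero measurableSet_Ioi
    (Ioc_subset_Ioi_self : Ioc (0 : ℝ) 1 ⊆ Ioi 0)]
  · refine setIntegral_congr_fun measurableSet_Ioc fun t ht ↦ ?_
    simp [riesz_of_le_one m ht.2]
  · intro t ht
    have : 1 ≤ t := by
      by_contra! h
      exact ht.2 ⟨ht.1, h.le⟩
    simp [riesz_of_one_le hm this]

theorem le_norm_add_natCast {s : ℂ} (hs : 0 ≤ s.re) (j : ℕ) : ‖s‖ ≤ ‖s + j‖ := by
  refine abs_le_of_sq_le_sq' ?_ (norm_nonneg _) |>.2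
  rw [Complex.sq_norm, Complex.sq_norm, Complex.normSq_apply, Complex.normSq_apply]
  have : (0 : ℝ) ≤ j := j.cast_nonneg
  simp only [Complex.add_re, Complex.natCast_re, Complex.add_im, Complex.natCast_im, add_zero]
  nlinarith

theorem norm_rieszMellin_le (m : ℕ) {s : ℂ} (hs : 0 < s.re) :
    ‖rieszMellin m s‖ ≤ m.factorial / ‖s‖ ^ (m + 1) := by
  have h0 : 0 < ‖s‖ := norm_pos_iff.2 (by rintro rfl; simp at hs)
  rw [rieszMellin, norm_div, Complex.norm_natCast, norm_prod]
  refine div_le_div_of_nonneg_left (by positivity) (by positivity) ?_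
  calc ‖s‖ ^ (m + 1) = ∏ j ∈ Finset.range (m + 1), ‖s‖ := by simp
    _ ≤ _ := Finset.prod_le_prod (fun _ _ ↦ norm_nonneg _) fun j _ ↦ le_norm_add_natCast hs.le j

theorem differentiableOn_rieszMellin (m : ℕ) :
    DifferentiableOn ℂ (rieszMellin m) {s | 0 < s.re} := by
  intro s hs
  refine DifferentiableAt.differentiableWithinAt ?_
  refine (differentiableAt_const _).div ?_ ?_
  · fun_prop
  · refine Finset.prod_ne_zero_iff.2 fun j _ h ↦ ?_
    have h1 : s.re + j = 0 := by simpa using congrArg Complex.re h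
    have h2 : 0 < s.re := hs
    have : (0 : ℝ) ≤ j := by positivity
    linarith

theorem norm_deriv_rieszMellin_le (m : ℕ) {s : ℂ} (hs : 1 ≤ s.re) :
    ‖deriv (rieszMellin m) s‖ ≤ 2 ^ (m + 2) * m.factorial / ‖s‖ ^ (m + 1) := by
  have h1 : 1 ≤ ‖s‖ := hs.trans (Complex.re_le_norm s)
  have hsub : ∀ z ∈ Metric.closedBall s (1 / 2), 0 < z.re ∧ ‖s‖ / 2 ≤ ‖z‖ := by
    intro z hz
    have hz1 : ‖z - s‖ ≤ 1 / 2 := by simpa [dist_eq_norm] using hz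
    have h2 := (abs_le.1 ((Complex.abs_re_le_norm (z - s)).trans hz1)).1
    simp only [Complex.sub_re] at h2
    have h3 := norm_sub_norm_le s z
    rw [norm_sub_rev] at h3
    exact ⟨by linarith, by linarith⟩
  have h2 : ‖deriv (rieszMellin m) s‖ ≤ (m.factorial / (‖s‖ / 2) ^ (m + 1)) / (1 / 2) := by
    refine Complex.norm_deriv_le_of_forall_mem_sphere_norm_le (by norm_num) ?_ fun z hz ↦ ?_
    · refine DifferentiableOn.diffContOnCl ?_
      refine (differentiableOn_rieszMellin m).mono ?_
      rw [closure_ball _ (by norm_num)]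
      exact fun z hz ↦ (hsub z hz).1
    · obtain ⟨h3, h4⟩ := hsub z (Metric.sphere_subset_closedBall hz)
      refine (norm_rieszMellin_le m h3).trans ?_
      gcongr
  refine h2.trans (le_of_eq ?_)
  rw [div_pow]
  field_simp
  ring

end RieszKernel

section Perron

theorem norm_mul_le_of_decay {A C : ℝ} {N m : ℕ} (hC : 0 ≤ C) (hNm : N + 1 ≤ m)
    {f g : ℂ → ℂ} {s : ℂ} (hs : 1 ≤ s.re)
    (hf : ‖f s‖ ≤ A / ‖s‖ ^ (m + 1)) (hg : ‖g s‖ ≤ C * (1 + ‖s‖) ^ N) :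
    ‖f s * g s‖ ≤ A * C * 2 ^ N / (1 + s.im ^ 2) := by
  have h1 : 1 ≤ ‖s‖ := hs.trans (Complex.re_le_norm s)
  have h0 : 0 < ‖s‖ := by linarith
  have hA : 0 ≤ A := by
    have h3 : 0 ≤ A / ‖s‖ ^ (m + 1) := (norm_nonneg _).trans hf
    by_contra! h
    exact absurd h3 (not_le.2 (div_neg_of_neg_of_pos h (by positivity)))
  have h2 : 1 + s.im ^ 2 ≤ ‖s‖ ^ 2 := by
    rw [Complex.sq_norm, Complex.normSq_apply]
    nlinarith
  have h4 : ‖s‖ ^ (N + 2) ≤ ‖s‖ ^ (m + 1) := pow_le_pow_right₀ h1 (by omega)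
  rw [norm_mul]
  calc ‖f s‖ * ‖g s‖ ≤ (A / ‖s‖ ^ (N + 2)) * (C * (2 * ‖s‖) ^ N) := by
        gcongr
        · exact hf.trans (by gcongr)
        · exact hg.trans (by gcongr; linarith)
    _ = A * C * 2 ^ N / ‖s‖ ^ 2 := by
        rw [mul_pow, pow_add]
        field_simp
    _ ≤ _ := by gcongr

theorem exists_rieszMellin_mul_logDerivError_bound :
    ∃ m : ℕ, 2 ≤ m ∧ ∃ K : ℝ, ∀ s : ℂ, 1 ≤ s.re → s.re ≤ 2 →
      ‖rieszMellin m s * logDerivError s‖ ≤ K / (1 + s.im ^ 2) ∧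
      ‖deriv (rieszMellin m) s * logDerivError s + rieszMellin m s * deriv logDerivError s‖ ≤
        K / (1 + s.im ^ 2) := by
  obtain ⟨C, N, hC, h1⟩ := polyBdd_logDerivError
  obtain ⟨D, L, hD, h2⟩ := polyBdd_deriv_logDerivError
  set m := N + L + 2 with hm
  set A : ℝ := 2 ^ (m + 2) * m.factorial with hA
  refine ⟨m, by omega, A * C * 2 ^ N + A * D * 2 ^ L, fun s hs hs2 ↦ ?_⟩
  have hB : ‖rieszMellin m s‖ ≤ A / ‖s‖ ^ (m + 1) := by
    refine (norm_rieszMellin_le m (by linarith)).trans ?_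
    gcongr
    rw [hA]
    exact le_mul_of_one_le_left (by positivity) (one_le_pow₀ (by norm_num))
  have hB' := norm_deriv_rieszMellin_le m hs
  have e1 := norm_mul_le_of_decay (by linarith) (by omega) hs hB (h1 s ⟨hs, hs2⟩)
  have e2 := norm_mul_le_of_decay (by linarith) (by omega) hs hB' (h1 s ⟨hs, hs2⟩)
  have e3 := norm_mul_le_of_decay (by linarith) (by omega) hs hB (h2 s ⟨hs, hs2⟩)
  have e4 : 0 ≤ A * D * 2 ^ L / (1 + s.im ^ 2) := by positivity
  constructor
  · rw [add_div]
    linarith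
  · refine (norm_add_le _ _).trans ?_
    rw [add_div]
    linarith

theorem continuous_vertical {f : ℂ → ℂ} {σ : ℝ} (hf : ∀ s : ℂ, s.re = σ → ContinuousAt f s) :
    Continuous fun y : ℝ ↦ f (σ + y * Complex.I) :=
  continuous_iff_continuousAt.2 fun y ↦
    ContinuousAt.comp (f := fun y : ℝ ↦ (σ + y * Complex.I : ℂ)) (hf _ (by simp)) (by fun_prop)

theorem continuousAt_rieszMellin (m : ℕ) {s : ℂ} (hs : 0 < s.re) :
    ContinuousAt (rieszMellin m) s :=
  ((differentiableOn_rieszMellin m).differentiableAt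
    ((isOpen_re_gt 0).mem_nhds hs)).continuousAt

theorem norm_rieszMellin_vertical_le {m : ℕ} (hm : m ≠ 0) {s : ℂ} (hs : 1 ≤ s.re) :
    ‖rieszMellin m s‖ ≤ m.factorial * (1 + s.im ^ 2)⁻¹ := by
  have := norm_mul_le_of_decay (N := 0) (C := 1) (g := fun _ ↦ 1) zero_le_one
    (Nat.one_le_iff_ne_zero.2 hm) hs
    (norm_rieszMellin_le m (by linarith)) (by simp)
  simpa [div_eq_mul_inv] using this

open MeasureTheory

theorem integrable_of_norm_le_inv_one_add_sq {f : ℝ → ℂ} (hf : AEStronglyMeasurable f) {K : ℝ}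
    (hK : ∀ y, ‖f y‖ ≤ K * (1 + y ^ 2)⁻¹) : Integrable f :=
  (integrable_inv_one_add_sq.const_mul K).mono' hf (.of_forall hK)

theorem verticalIntegrable_rieszMellin {m : ℕ} (hm : m ≠ 0) {σ : ℝ} (hσ : 1 ≤ σ) :
    Integrable fun y : ℝ ↦ rieszMellin m (σ + y * Complex.I) := by
  refine integrable_of_norm_le_inv_one_add_sq (K := m.factorial) (continuous_vertical fun s hs ↦
    continuousAt_rieszMellin m (by linarith)).aestronglyMeasurable fun y ↦ ?_
  simpa using norm_rieszMellin_vertical_le hm (s := σ + y * Complex.I) (by simpa using hσ)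

open Complex in
theorem integral_cpow_mul_rieszMellin {m : ℕ} (hm : m ≠ 0) {σ : ℝ} (hσ : 1 ≤ σ) {u : ℝ}
    (hu : 0 < u) :
    ∫ y : ℝ, (u : ℂ) ^ (-(σ + y * I)) * rieszMellin m (σ + y * I) =
      2 * Real.pi * (riesz m u : ℂ) := by
  have e : ∀ y : ℝ, mellin (fun u ↦ (riesz m u : ℂ)) (σ + y * I) = rieszMellin m (σ + y * I) :=
    fun y ↦ mellin_riesz hm (by simp; linarith)
  have h := mellinInv_mellin_eq σ (fun u ↦ (riesz m u : ℂ)) hu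
    (mellinConvergent_riesz hm (by simp; linarith))
    (by simpa only [VerticalIntegrable, e] using verticalIntegrable_rieszMellin hm hσ)
    (continuous_ofReal.comp (continuous_riesz m)).continuousAt
  simp only [mellinInv, e, smul_eq_mul, real_smul] at h
  rw [← h]
  generalize ∫ y : ℝ, (u : ℂ) ^ (-(σ + y * I)) * rieszMellin m (σ + y * I) = J
  push_cast
  have : (Real.pi : ℂ) ≠ 0 := ofReal_ne_zero.2 Real.pi_ne_zero
  field_simp

/-- The Riesz mean of `Λ - 1` is the vertical integral of its Dirichlet series against the Mellin
transform of the weight. -/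
theorem sum_vonMangoldt_sub_one_mul_riesz {m : ℕ} (hm : m ≠ 0) {σ : ℝ} (hσ : 1 < σ) {x : ℝ}
    (hx : 0 < x) :
    2 * Real.pi * ((∑ n ∈ Finset.Icc 1 ⌊x⌋₊,
      (ArithmeticFunction.vonMangoldt n - 1) * riesz m (n / x) : ℝ) : ℂ) =
      ∫ y : ℝ, (x : ℂ) ^ (σ + y * Complex.I : ℂ) *
        (rieszMellin m (σ + y * Complex.I) * logDerivError (σ + y * Complex.I)) := by
  set a : ℕ → ℂ := fun n ↦ ((ArithmeticFunction.vonMangoldt n : ℝ) : ℂ) - 1 with ha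
  set F : ℕ → ℝ → ℂ := fun n y ↦ LSeries.term a (σ + y * Complex.I) n *
    ((x : ℂ) ^ (σ + y * Complex.I : ℂ) * rieszMellin m (σ + y * Complex.I)) with hF
  have hre : ∀ y : ℝ, (σ + y * Complex.I : ℂ).re = σ := fun y ↦ by simp
  have hxC : (x : ℂ) ≠ 0 := Complex.ofReal_ne_zero.2 hx.ne'
  have hFn : ∀ n y, n ≠ 0 → F n y = a n *
      (((n / x : ℝ) : ℂ) ^ (-(σ + y * Complex.I)) * rieszMellin m (σ + y * Complex.I)) := by
    intro n y hn
    have hnx : (((n / x : ℝ) : ℂ)) ^ (-(σ + y * Complex.I)) =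
        (x : ℂ) ^ (σ + y * Complex.I : ℂ) / (n : ℂ) ^ (σ + y * Complex.I : ℂ) := by
      rw [Complex.cpow_neg, Complex.ofReal_div,
        Complex.div_cpow_ofReal_nonneg n.cast_nonneg hx.le, inv_div, Complex.ofReal_natCast]
    rw [hF, hnx]
    simp only [LSeries.term_def, hn, if_false]
    ring
  have hbound : ∀ n y, ‖F n y‖ ≤ ‖LSeries.term a σ n‖ * x ^ σ * m.factorial * (1 + y ^ 2)⁻¹ := by
    intro n y
    have h1 : ‖LSeries.term a (σ + y * Complex.I) n‖ = ‖LSeries.term a σ n‖ := by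
      rw [LSeries.norm_term_eq, LSeries.norm_term_eq, hre, Complex.ofReal_re]
    have h2 := norm_rieszMellin_vertical_le hm (s := σ + y * Complex.I) (by rw [hre]; exact hσ.le)
    rw [hF]
    simp only [norm_mul, h1, Complex.norm_cpow_eq_rpow_re_of_pos hx, hre]
    have h3 : (σ + y * Complex.I : ℂ).im = y := by simp
    rw [h3] at h2
    calc _ ≤ ‖LSeries.term a σ n‖ * (x ^ σ * (m.factorial * (1 + y ^ 2)⁻¹)) := by gcongr
      _ = _ := by ring
  have hint : ∀ n, Integrable (F n) := by
    intro n
    refine integrable_of_norm_le_inv_one_add_sq ?_ (hbound n)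
    rcases eq_or_ne n 0 with rfl | hn
    · simpa [hF] using aestronglyMeasurable_const
    refine Continuous.aestronglyMeasurable ?_
    rw [funext fun y ↦ hFn n y hn]
    refine continuous_const.mul (Continuous.mul ?_ (continuous_vertical fun s hs ↦
      continuousAt_rieszMellin m (by linarith)))
    refine Continuous.const_cpow (by fun_prop) (.inl ?_)
    have : (n : ℝ) / x ≠ 0 := by positivity
    exact_mod_cast this
  have hsum : Summable fun n ↦ ∫ y, ‖F n y‖ := by
    have h1 : Summable fun n ↦ ‖LSeries.term a σ n‖ :=
      (lSeriesHasSum_vonMangoldt_sub_one (s := σ) (by simpa using hσ)).LSeriesSummable.norm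
    refine Summable.of_nonneg_of_le (fun n ↦ integral_nonneg fun y ↦ norm_nonneg _) (fun n ↦ ?_)
      (h1.mul_right (x ^ σ * m.factorial * ∫ y : ℝ, (1 + y ^ 2)⁻¹))
    calc ∫ y, ‖F n y‖ ≤ ∫ y, ‖LSeries.term a σ n‖ * x ^ σ * m.factorial * (1 + y ^ 2)⁻¹ :=
          integral_mono (hint n).norm (integrable_inv_one_add_sq.const_mul _) (hbound n)
      _ = _ := by
          rw [integral_const_mul]
          ring
  have hH := hasSum_integral_of_summable_integral_norm hint hsum
  have htsum : ∀ y, ∑' n, F n y = (x : ℂ) ^ (σ + y * Complex.I : ℂ) *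
        (rieszMellin m (σ + y * Complex.I) * logDerivError (σ + y * Complex.I)) := by
    intro y
    have := (lSeriesHasSum_vonMangoldt_sub_one (s := σ + y * Complex.I)
      (by rw [hre]; exact hσ)).mul_right
      ((x : ℂ) ^ (σ + y * Complex.I : ℂ) * rieszMellin m (σ + y * Complex.I))
    rw [this.tsum_eq]
    ring
  simp only [htsum] at hH
  have hval : ∀ n : ℕ, n ≠ 0 → ∫ y, F n y = 2 * Real.pi * (a n * (riesz m (n / x) : ℂ)) := by
    intro n hn
    rw [funext fun y ↦ hFn n y hn, integral_const_mul,
      integral_cpow_mul_rieszMellin hm hσ.le (by positivity)]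
    ring
  refine (HasSum.unique hH ?_).symm
  have h0 := hasSum_sum_of_ne_finset_zero (L := .unconditional ℕ)
    (f := fun n ↦ ∫ y, F n y) (s := Finset.Icc 1 ⌊x⌋₊)
    (fun n hn ↦ by
      rcases eq_or_ne n 0 with rfl | hn0
      · simp [hF]
      have : x < n := by
        rw [Finset.mem_Icc, not_and] at hn
        exact (Nat.floor_lt hx.le).1 (not_le.1 (hn (Nat.one_le_iff_ne_zero.2 hn0)))
      rw [hval n hn0, riesz_of_one_le hm ((one_le_div hx).2 this.le)]
      simp)
  refine Eq.subst (motive := HasSum _) ?_ h0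
  push_cast
  rw [Finset.mul_sum]
  refine Finset.sum_congr rfl fun n hn ↦ ?_
  rw [hval n (by have := (Finset.mem_Icc.1 hn).1; omega)]

end Perron

section RieszMeans

open MeasureTheory Filter Topology

theorem sum_vonMangoldt_sub_one_mul_riesz_line {m : ℕ} (hm : m ≠ 0) {K : ℝ}
    (hK : ∀ s : ℂ, 1 ≤ s.re → s.re ≤ 2 →
      ‖rieszMellin m s * logDerivError s‖ ≤ K / (1 + s.im ^ 2)) {x : ℝ} (hx : 1 ≤ x) :
    2 * Real.pi * ((∑ n ∈ Finset.Icc 1 ⌊x⌋₊,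
      (ArithmeticFunction.vonMangoldt n - 1) * riesz m (n / x) : ℝ) : ℂ) =
      ∫ y : ℝ, (x : ℂ) ^ (1 + y * Complex.I : ℂ) *
        (rieszMellin m (1 + y * Complex.I) * logDerivError (1 + y * Complex.I)) := by
  have hx0 : 0 < x := by linarith
  have hxC : (x : ℂ) ≠ 0 := Complex.ofReal_ne_zero.2 hx0.ne'
  have hcont : ∀ s : ℂ, 1 ≤ s.re →
      ContinuousAt (fun s ↦ (x : ℂ) ^ s * (rieszMellin m s * logDerivError s)) s := fun s hs ↦
    (continuousAt_const_cpow hxC).mul ((continuousAt_rieszMellin m (by linarith)).mul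
      (hasDerivAt_logDerivError hs).continuousAt)
  have hre : ∀ σ y : ℝ, (σ + y * Complex.I : ℂ).re = σ := fun σ y ↦ by simp
  have hmem : ∀ᶠ σ : ℝ in 𝓝[>] 1, 1 < σ ∧ σ ≤ 2 := by
    filter_upwards [Ioc_mem_nhdsGT (show (1 : ℝ) < 2 by norm_num)] with σ hσ using hσ
  have hlim : Tendsto (fun σ : ℝ ↦ ∫ y : ℝ, (x : ℂ) ^ (σ + y * Complex.I : ℂ) *
        (rieszMellin m (σ + y * Complex.I) * logDerivError (σ + y * Complex.I))) (𝓝[>] 1)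
      (𝓝 (∫ y : ℝ, (x : ℂ) ^ (1 + y * Complex.I : ℂ) *
        (rieszMellin m (1 + y * Complex.I) * logDerivError (1 + y * Complex.I)))) := by
    refine tendsto_integral_filter_of_dominated_convergence
      (fun y ↦ x ^ (2 : ℝ) * K * (1 + y ^ 2)⁻¹) ?_ ?_ (integrable_inv_one_add_sq.const_mul _) ?_
    · filter_upwards [hmem] with σ hσ
      exact (continuous_vertical (f := fun s ↦ (x : ℂ) ^ s * (rieszMellin m s * logDerivError s))
        fun s hs ↦ hcont s (by linarith)).aestronglyMeasurable
    · filter_upwards [hmem] with σ hσ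
      refine .of_forall fun y ↦ ?_
      have h1 := hK (σ + y * Complex.I) (by rw [hre]; exact hσ.1.le) (by rw [hre]; exact hσ.2)
      have h3 : (σ + y * Complex.I : ℂ).im = y := by simp
      rw [h3, div_eq_mul_inv] at h1
      rw [norm_mul, Complex.norm_cpow_eq_rpow_re_of_pos hx0, hre, mul_assoc]
      exact mul_le_mul (Real.rpow_le_rpow_of_exponent_le hx hσ.2) h1 (norm_nonneg _)
        (Real.rpow_nonneg hx0.le _)
    · refine .of_forall fun y ↦ ?_
      have h1 : Tendsto (fun σ : ℝ ↦ (σ + y * Complex.I : ℂ)) (𝓝[>] 1)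
          (𝓝 (1 + y * Complex.I)) := by
        have : Continuous fun σ : ℝ ↦ (σ + y * Complex.I : ℂ) := by fun_prop
        simpa using (this.tendsto 1).mono_left nhdsWithin_le_nhds
      exact (hcont (1 + y * Complex.I) (by simp)).tendsto.comp h1
  refine tendsto_nhds_unique (tendsto_const_nhds.congr' ?_) hlim
  filter_upwards [hmem] with σ hσ
  exact sum_vonMangoldt_sub_one_mul_riesz hm hσ.1 hx0

open FourierTransform in
/-- A prime number theorem for Riesz means, with a little-o of `x / log x` error term. -/
theorem exists_tendsto_sum_vonMangoldt_sub_one_mul_riesz :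
    ∃ m : ℕ, 2 ≤ m ∧ Tendsto (fun x : ℝ ↦ (∑ n ∈ Finset.Icc 1 ⌊x⌋₊,
      (ArithmeticFunction.vonMangoldt n - 1) * riesz m (n / x)) * Real.log x / x) atTop (𝓝 0) := by
  obtain ⟨m, hm, K, hK⟩ := exists_rieszMellin_mul_logDerivError_bound
  refine ⟨m, hm, ?_⟩
  set Φ : ℝ → ℂ := fun y ↦ rieszMellin m (1 + y * Complex.I) * logDerivError (1 + y * Complex.I)
    with hΦ
  have hre : ∀ y : ℝ, (1 + y * Complex.I : ℂ).re = 1 := fun y ↦ by simp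
  have him : ∀ y : ℝ, (1 + y * Complex.I : ℂ).im = y := fun y ↦ by simp
  have hderiv : ∀ y : ℝ, HasDerivAt Φ
      ((deriv (rieszMellin m) (1 + y * Complex.I) * logDerivError (1 + y * Complex.I) +
        rieszMellin m (1 + y * Complex.I) * deriv logDerivError (1 + y * Complex.I)) *
          Complex.I) y := by
    intro y
    have h1 : HasDerivAt (rieszMellin m) (deriv (rieszMellin m) (1 + y * Complex.I))
        (1 + y * Complex.I) :=
      ((differentiableOn_rieszMellin m).differentiableAt
        ((isOpen_re_gt 0).mem_nhds (by
          simp))).hasDerivAt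
    have h2 := (hasDerivAt_logDerivError (s := 1 + y * Complex.I)
      (hre y).ge).differentiableAt.hasDerivAt
    have h3 : HasDerivAt (fun y : ℝ ↦ (1 + y * Complex.I : ℂ)) Complex.I y := by
      simpa using ((Complex.ofRealCLM.hasDerivAt (x := y)).mul_const Complex.I).const_add 1
    exact (h1.mul h2).comp y h3
  have hdiff : Differentiable ℝ Φ := fun y ↦ (hderiv y).differentiableAt
  have hint : Integrable Φ := by
    refine integrable_of_norm_le_inv_one_add_sq (K := K) hdiff.continuous.aestronglyMeasurable
      fun y ↦ ?_
    have := (hK (1 + y * Complex.I) (hre y).ge (by rw [hre]; norm_num)).1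
    rwa [him, div_eq_mul_inv] at this
  have hint' : Integrable (deriv Φ) := by
    refine integrable_of_norm_le_inv_one_add_sq (K := K)
      (stronglyMeasurable_deriv Φ).aestronglyMeasurable fun y ↦ ?_
    have := (hK (1 + y * Complex.I) (hre y).ge (by rw [hre]; norm_num)).2
    rw [(hderiv y).deriv, norm_mul, Complex.norm_I, mul_one]
    rwa [him, div_eq_mul_inv] at this
  have hRL : Tendsto (fun x : ℝ ↦ 𝓕 (deriv Φ) (-Real.log x / (2 * Real.pi))) atTop (𝓝 0) := by
    refine ((Real.zero_at_infty_fourier (deriv Φ)).mono_left atBot_le_cocompact).comp ?_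
    exact (tendsto_neg_atTop_atBot.comp Real.tendsto_log_atTop).atBot_div_const (by positivity)
  refine squeeze_zero_norm' (a := fun x ↦ ‖𝓕 (deriv Φ) (-Real.log x / (2 * Real.pi))‖ / (2 * Real.pi))
    ?_ (by simpa using hRL.norm.div_const (2 * Real.pi))
  filter_upwards [eventually_ge_atTop 1] with x hx
  have hx0 : 0 < x := by linarith
  have h1 := sum_vonMangoldt_sub_one_mul_riesz_line (by omega) (fun s h1 h2 ↦ (hK s h1 h2).1) hx
  have h2 : ∫ y : ℝ, (x : ℂ) ^ (1 + y * Complex.I : ℂ) *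
        (rieszMellin m (1 + y * Complex.I) * logDerivError (1 + y * Complex.I)) =
      x * 𝓕 Φ (-Real.log x / (2 * Real.pi)) := by
    rw [Real.fourier_real_eq_integral_exp_smul, ← integral_const_mul]
    refine integral_congr_ae (.of_forall fun y ↦ ?_)
    have hxC : (x : ℂ) ≠ 0 := Complex.ofReal_ne_zero.2 hx0.ne'
    have e : (x : ℂ) ^ (y * Complex.I : ℂ) = Complex.exp
        (((-2 * Real.pi * y * (-Real.log x / (2 * Real.pi)) : ℝ) : ℂ) * Complex.I) := by
      rw [Complex.cpow_def_of_ne_zero hxC, ← Complex.ofReal_log hx0.le]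
      congr 1
      have : (-2 * Real.pi * y * (-Real.log x / (2 * Real.pi)) : ℝ) = Real.log x * y := by
        have := Real.pi_ne_zero
        field_simp
      rw [this]
      push_cast
      ring
    simp only [smul_eq_mul, ← e, hΦ]
    rw [Complex.cpow_add _ _ hxC, Complex.cpow_one]
    ring
  rw [h2] at h1
  rw [Real.fourier_deriv hint hdiff hint']
  have h3 := congrArg norm h1
  simp only [norm_mul, Complex.norm_real, Complex.norm_ofNat, Real.norm_eq_abs,
    abs_of_pos Real.pi_pos, abs_of_pos hx0] at h3
  simp only [norm_smul, norm_mul, norm_div, Complex.norm_real, Complex.norm_ofNat, Complex.norm_I,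
    Real.norm_eq_abs, abs_of_pos Real.pi_pos, abs_of_pos hx0, Complex.ofReal_div,
    Complex.ofReal_neg, norm_neg, Complex.ofReal_mul, Complex.ofReal_ofNat]
  have : ‖𝓕 Φ (-Real.log x / (2 * Real.pi))‖ = 2 * Real.pi * |∑ n ∈ Finset.Icc 1 ⌊x⌋₊,
      (ArithmeticFunction.vonMangoldt n - 1) * riesz m (n / x)| / x := by
    rw [h3]
    field_simp
  rw [this]
  refine le_of_eq ?_
  have := Real.pi_ne_zero
  field_simp

theorem integral_riesz {m : ℕ} (hm : m ≠ 0) {b : ℝ} (hb : 1 ≤ b) :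
    ∫ u in (0 : ℝ)..b, riesz m u = 1 / (m + 1) := by
  have hc := continuous_riesz m
  rw [← intervalIntegral.integral_add_adjacent_intervals (b := 1) (hc.intervalIntegrable _ _)
    (hc.intervalIntegrable _ _)]
  have h1 : ∫ u in (0 : ℝ)..1, riesz m u = 1 / (m + 1) := by
    rw [intervalIntegral.integral_congr (g := fun u ↦ (1 - u) ^ m)]
    · rw [intervalIntegral.integral_comp_sub_left (fun u ↦ u ^ m)]
      simp
    · intro u hu
      rw [Set.uIcc_of_le zero_le_one] at hu
      exact riesz_of_le_one m hu.2
  have h2 : ∫ u in (1 : ℝ)..b, riesz m u = 0 := by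
    rw [intervalIntegral.integral_congr (g := fun _ ↦ 0)]
    · simp
    · intro u hu
      rw [Set.uIcc_of_le hb] at hu
      exact riesz_of_one_le hm hu.1
  rw [h1, h2, add_zero]

theorem abs_sum_riesz_sub_le {m : ℕ} (hm : m ≠ 0) {x : ℝ} (hx : 0 < x) :
    |∑ n ∈ Finset.Icc 1 ⌊x⌋₊, riesz m (n / x) - x / (m + 1)| ≤ 1 := by
  set N := ⌊x⌋₊ + 1 with hN
  have hxN : x ≤ N := by
    rw [hN]
    push_cast
    exact (Nat.lt_floor_add_one x).le
  have hanti : AntitoneOn (fun t : ℝ ↦ riesz m (t / x)) (Set.Icc 0 (0 + (N : ℝ))) :=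
    fun a _ b _ hab ↦ riesz_antitone m (by gcongr)
  have hI : ∫ t in (0 : ℝ)..0 + N, riesz m (t / x) = x / (m + 1) := by
    rw [zero_add, intervalIntegral.integral_comp_div _ hx.ne', zero_div,
      integral_riesz hm ((one_le_div hx).2 hxN), smul_eq_mul]
    ring
  have h1 := hanti.sum_le_integral
  have h2 := hanti.integral_le_sum
  simp only [zero_add] at h1 h2 hI
  rw [hI] at h1 h2
  have e1 : ∑ i ∈ Finset.range N, riesz m (((i + 1 : ℕ) : ℝ) / x) =
      ∑ n ∈ Finset.Icc 1 ⌊x⌋₊, riesz m (n / x) := by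
    rw [hN, Finset.sum_range_succ, riesz_of_one_le hm ((one_le_div hx).2 hxN), add_zero,
      ← Finset.Ico_add_one_right_eq_Icc, Finset.sum_Ico_eq_sum_range]
    simp [add_comm]
  have e2 : ∑ i ∈ Finset.range N, riesz m ((i : ℝ) / x) =
      1 + ∑ n ∈ Finset.Icc 1 ⌊x⌋₊, riesz m (n / x) := by
    rw [← e1, hN, Finset.sum_range_succ', Finset.sum_range_succ,
      riesz_of_one_le hm ((one_le_div hx).2 hxN)]
    simp [riesz]
    ring
  rw [e1] at h1
  rw [e2] at h2
  rw [abs_le]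
  constructor <;> linarith

/-- The Riesz mean of the Chebyshev function `θ`. -/
noncomputable def thetaRiesz (m : ℕ) (x : ℝ) : ℝ :=
  ∑ p ∈ Finset.Ioc 0 ⌊x⌋₊ with p.Prime, Real.log p * riesz m (p / x)

theorem abs_sum_vonMangoldt_riesz_sub_thetaRiesz_le (m : ℕ) {x : ℝ} (hx : 1 ≤ x) :
    |∑ n ∈ Finset.Icc 1 ⌊x⌋₊, ArithmeticFunction.vonMangoldt n * riesz m (n / x) -
      thetaRiesz m x| ≤ 2 * √x * Real.log x := by
  have hI : Finset.Icc 1 ⌊x⌋₊ = Finset.Ioc 0 ⌊x⌋₊ := rfl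
  have e : ∑ n ∈ Finset.Icc 1 ⌊x⌋₊, ArithmeticFunction.vonMangoldt n * riesz m (n / x) -
      thetaRiesz m x = ∑ n ∈ Finset.Ioc 0 ⌊x⌋₊ with ¬n.Prime,
        ArithmeticFunction.vonMangoldt n * riesz m (n / x) := by
    rw [hI, ← Finset.sum_filter_add_sum_filter_not _ Nat.Prime, thetaRiesz]
    have : ∑ p ∈ Finset.Ioc 0 ⌊x⌋₊ with p.Prime, Real.log p * riesz m (p / x) =
        ∑ p ∈ Finset.Ioc 0 ⌊x⌋₊ with p.Prime,
          ArithmeticFunction.vonMangoldt p * riesz m (p / x) :=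
      Finset.sum_congr rfl fun p hp ↦ by
        rw [ArithmeticFunction.vonMangoldt_apply_prime (Finset.mem_filter.1 hp).2]
    rw [this]
    ring
  rw [e, abs_of_nonneg (Finset.sum_nonneg fun n _ ↦
    mul_nonneg ArithmeticFunction.vonMangoldt_nonneg (riesz_nonneg _ _))]
  refine le_trans ?_ (Chebyshev.psi_sub_theta_le hx)
  rw [Chebyshev.psi_sub_theta_eq_sum_not_prime]
  exact Finset.sum_le_sum fun n _ ↦ mul_le_of_le_one_right ArithmeticFunction.vonMangoldt_nonneg
    (riesz_le_one m (by positivity))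

theorem exists_tendsto_thetaRiesz :
    ∃ m : ℕ, 2 ≤ m ∧ Tendsto (fun x : ℝ ↦ (thetaRiesz m x - x / (m + 1)) * Real.log x / x)
      atTop (𝓝 0) := by
  obtain ⟨m, hm, h⟩ := exists_tendsto_sum_vonMangoldt_sub_one_mul_riesz
  refine ⟨m, hm, ?_⟩
  have hlog : Tendsto (fun x : ℝ ↦ Real.log x / x) atTop (𝓝 0) :=
    Real.isLittleO_log_id_atTop.tendsto_div_nhds_zero
  have hlog2 : Tendsto (fun x : ℝ ↦ Real.log x ^ 2 / √x) atTop (𝓝 0) := by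
    have := (isLittleO_log_rpow_rpow_atTop (s := 1 / 2) 2 (by norm_num)).tendsto_div_nhds_zero
    simpa [Real.sqrt_eq_rpow] using this
  have hlim : Tendsto (fun x : ℝ ↦ |(∑ n ∈ Finset.Icc 1 ⌊x⌋₊,
      (ArithmeticFunction.vonMangoldt n - 1) * riesz m (n / x)) * Real.log x / x| +
      Real.log x / x + 2 * (Real.log x ^ 2 / √x)) atTop (𝓝 0) := by
    simpa using (h.abs.add hlog).add (hlog2.const_mul 2)
  refine squeeze_zero_norm' ?_ hlim
  filter_upwards [eventually_ge_atTop 1] with x hx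
  have hx0 : 0 < x := by linarith
  have hl : 0 ≤ Real.log x := Real.log_nonneg hx
  have h1 := abs_sum_riesz_sub_le (m := m) (by omega) hx0
  have h2 := abs_sum_vonMangoldt_riesz_sub_thetaRiesz_le m hx
  simp only [sub_mul, one_mul, Finset.sum_sub_distrib]
  set A := ∑ n ∈ Finset.Icc 1 ⌊x⌋₊, ArithmeticFunction.vonMangoldt n * riesz m (n / x)
  set B := ∑ n ∈ Finset.Icc 1 ⌊x⌋₊, riesz m (n / x)
  have e : Real.log x ^ 2 / √x = √x * Real.log x * (Real.log x / x) := by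
    have hs : √x ≠ 0 := by positivity
    field_simp
    rw [Real.sq_sqrt hx0.le]
  rw [e, ← sub_mul, ← sub_mul, mul_div_assoc, mul_div_assoc, Real.norm_eq_abs, abs_mul, abs_mul,
    abs_of_nonneg (show 0 ≤ Real.log x / x by positivity)]
  calc |thetaRiesz m x - x / (m + 1)| * (Real.log x / x)
      ≤ (|A - B| + 1 + 2 * √x * Real.log x) * (Real.log x / x) := by
        gcongr
        rw [abs_le] at h1 h2 ⊢
        have h3 := neg_abs_le (A - B)
        have h4 := le_abs_self (A - B)
        constructor <;> linarith
    _ = _ := by ring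

theorem sum_log_div_prime_eq {y : ℝ} (hy : 0 < y) :
    ∑ p ∈ Finset.Ioc 0 ⌊y⌋₊ with p.Prime, Real.log (y / p) =
      Nat.primeCounting ⌊y⌋₊ * Real.log y - Chebyshev.theta y := by
  have hcard : Nat.primeCounting ⌊y⌋₊ = (Finset.filter Nat.Prime (Finset.Ioc 0 ⌊y⌋₊)).card := by
    rw [Nat.primeCounting, Nat.primeCounting', Nat.count_eq_card_filter_range]
    congr 1
    ext p
    simp only [Finset.mem_filter, Finset.mem_range, Finset.mem_Ioc]
    exact ⟨fun h ↦ ⟨⟨h.2.pos, by omega⟩, h.2⟩, fun h ↦ ⟨by omega, h.2⟩⟩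
  rw [hcard, ← nsmul_eq_mul, ← Finset.sum_const, Chebyshev.theta, ← Finset.sum_sub_distrib]
  refine Finset.sum_congr rfl fun p hp ↦ ?_
  have : (p : ℝ) ≠ 0 := by exact_mod_cast (Finset.mem_filter.1 hp).2.ne_zero
  rw [Real.log_div hy.ne' this]

theorem eventually_sum_log_div_prime_le {ε : ℝ} (hε : 0 < ε) :
    ∀ᶠ y : ℝ in atTop, ∑ p ∈ Finset.Ioc 0 ⌊y⌋₊ with p.Prime, Real.log (y / p) ≤ ε * y := by
  obtain ⟨C, hC⟩ := Chebyshev.integral_theta_div_log_sq_isBigO.bound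
  filter_upwards [hC, eventually_ge_atTop 2,
    Real.tendsto_log_atTop.eventually_ge_atTop (max 1 (|C| / ε))] with y hy hy2 hl
  have hl1 : 1 ≤ Real.log y := (le_max_left _ _).trans hl
  have hl2 : |C| / ε ≤ Real.log y := (le_max_right _ _).trans hl
  have hl0 : 0 < Real.log y := by linarith
  rw [sum_log_div_prime_eq (by linarith), Chebyshev.primeCounting_eq_theta_div_log_add_integral hy2]
  set I := ∫ t in (2 : ℝ)..y, Chebyshev.theta t / (t * Real.log t ^ 2)
  have e : (Chebyshev.theta y / Real.log y + I) * Real.log y - Chebyshev.theta y =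
      I * Real.log y := by
    field_simp
    ring
  rw [e]
  have h1 : I ≤ |C| * (y / Real.log y ^ 2) := by
    refine (le_abs_self I).trans (hy.trans ?_)
    rw [Real.norm_of_nonneg (show 0 ≤ y / Real.log y ^ 2 by positivity)]
    exact mul_le_mul_of_nonneg_right (le_abs_self C) (by positivity)
  calc I * Real.log y ≤ |C| * (y / Real.log y ^ 2) * Real.log y := by gcongr
    _ = |C| / Real.log y * y := by field_simp
    _ ≤ ε * y := by
      have : |C| / Real.log y ≤ ε := by
        rw [div_le_iff₀ hε] at hl2
        rw [div_le_iff₀ hl0]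
        linarith
      gcongr

theorem riesz_mul_log_le {m : ℕ} (hm : 2 ≤ m) {x z w : ℝ} (hz : 0 < z) (hzw : z ≤ w) (hwx : w ≤ x)
    (hx : x ≤ 2 * z * Real.log z) :
    riesz m (w / x) * Real.log w ≤ riesz m (z / x) * Real.log z := by
  have hx0 : 0 < x := by linarith
  have hw : 0 < w := by linarith
  have hlz : 0 < Real.log z := by
    by_contra! h
    nlinarith
  have hb0 : 0 ≤ 1 - w / x := sub_nonneg.2 ((div_le_one hx0).2 hwx)
  have hba : 1 - w / x ≤ 1 - z / x := by gcongr
  have ha1 : 1 - z / x ≤ 1 := by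
    have : 0 < z / x := by positivity
    linarith
  have hlog : Real.log w ≤ Real.log z * (1 + 2 * ((1 - z / x) - (1 - w / x))) := by
    have h1 := Real.log_le_sub_one_of_pos (show 0 < w / z by positivity)
    rw [Real.log_div (by linarith) hz.ne'] at h1
    have h2 : w / z - 1 ≤ Real.log z * (2 * (w / x - z / x)) := by
      have : w / z - 1 = (w - z) * (1 / z) := by field_simp
      rw [this]
      have h3 : 1 / z ≤ 2 * Real.log z / x := by
        rw [div_le_div_iff₀ hz hx0]
        linarith
      calc (w - z) * (1 / z) ≤ (w - z) * (2 * Real.log z / x) := by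
            gcongr
        _ = _ := by ring
    linarith
  rw [riesz_of_le_one m ((div_le_one hx0).2 hwx),
    riesz_of_le_one m ((div_le_one hx0).2 (hzw.trans hwx))]
  set a := 1 - z / x
  set b := 1 - w / x
  obtain ⟨r, rfl⟩ := Nat.exists_eq_add_of_le' hm
  have h2 : b ^ 2 * Real.log w ≤ a ^ 2 * Real.log z := by
    have h3 : b ^ 2 * (1 + 2 * (a - b)) ≤ a ^ 2 := by
      have h4 : b ^ 2 ≤ b := by nlinarith
      have h5 : 0 ≤ (b - b ^ 2) * (a - b) := mul_nonneg (by linarith) (by linarith)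
      nlinarith [sq_nonneg (a - b)]
    calc b ^ 2 * Real.log w ≤ b ^ 2 * (Real.log z * (1 + 2 * (a - b))) := by gcongr
      _ = b ^ 2 * (1 + 2 * (a - b)) * Real.log z := by ring
      _ ≤ _ := by gcongr
  rw [pow_add, pow_add, mul_assoc, mul_assoc]
  have h4 : 0 ≤ a ^ 2 * Real.log z := by positivity
  calc b ^ r * (b ^ 2 * Real.log w) ≤ b ^ r * (a ^ 2 * Real.log z) := by gcongr
    _ ≤ a ^ r * (a ^ 2 * Real.log z) := by gcongr

/-- A nonincreasing weight which is at least `riesz m (z / x) * log z`. -/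
noncomputable def rieszLog (m : ℕ) (x z : ℝ) : ℝ :=
  riesz m (z / x) * max (Real.log z) (Real.log (x / Real.log x))

theorem two_mul_log_le {t : ℝ} (ht : 0 < t) : 2 * Real.log t ≤ t := by
  have h1 := Real.log_le_sub_one_of_pos (show 0 < t / 2 by positivity)
  rw [Real.log_div ht.ne' (by norm_num)] at h1
  have h2 := Real.log_two_lt_d9
  linarith

theorem one_le_div_log {x : ℝ} (hx0 : 0 < x) (hx : 1 ≤ Real.log x) : 1 ≤ x / Real.log x := by
  rw [one_le_div (by linarith)]
  linarith [Real.log_le_sub_one_of_pos hx0]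

theorem log_div_log_nonneg {x : ℝ} (hx0 : 0 < x) (hx : 1 ≤ Real.log x) :
    0 ≤ Real.log (x / Real.log x) :=
  Real.log_nonneg (one_le_div_log hx0 hx)

theorem rieszLog_nonneg (m : ℕ) {x : ℝ} (hx0 : 0 < x) (hx : 1 ≤ Real.log x) (z : ℝ) :
    0 ≤ rieszLog m x z :=
  mul_nonneg (riesz_nonneg _ _) (le_max_of_le_right (log_div_log_nonneg hx0 hx))

theorem rieszLog_antitoneOn {m : ℕ} (hm : 2 ≤ m) {x : ℝ} (hx0 : 0 < x) (hx : 1 ≤ Real.log x) :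
    AntitoneOn (rieszLog m x) (Set.Ici 0) := by
  intro z hz w hw hzw
  simp only [Set.mem_Ici] at hz hw
  rcases le_or_gt x w with hxw | hwx
  · rw [rieszLog, riesz_of_one_le (by omega) ((one_le_div hx0).2 hxw), zero_mul]
    exact rieszLog_nonneg m hx0 hx z
  have hY1 := one_le_div_log hx0 hx
  have hlY := log_div_log_nonneg hx0 hx
  have hY : x ≤ 2 * (x / Real.log x) * Real.log (x / Real.log x) := by
    have hT : 0 < Real.log x := by linarith
    have h1 := two_mul_log_le hT
    rw [Real.log_div hx0.ne' hT.ne']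
    calc x = x / Real.log x * Real.log x := by field_simp
      _ ≤ x / Real.log x * (2 * (Real.log x - Real.log (Real.log x))) := by
        gcongr
        linarith
      _ = _ := by ring
  unfold rieszLog
  set Y := x / Real.log x
  have hanti : ∀ {a b : ℝ}, a ≤ b → riesz m (b / x) ≤ riesz m (a / x) := fun h ↦
    riesz_antitone m (by gcongr)
  rcases le_or_gt w Y with hwY | hYw
  · have h1 : max (Real.log w) (Real.log Y) = Real.log Y := by
      refine max_eq_right ?_
      rcases hw.eq_or_lt with rfl | hw0
      · rwa [Real.log_zero]
      · exact Real.log_le_log hw0 hwY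
    rw [h1]
    exact mul_le_mul (hanti hzw) (le_max_right _ _) hlY (riesz_nonneg _ _)
  · have h1 : max (Real.log w) (Real.log Y) = Real.log w :=
      max_eq_left (Real.log_le_log (by linarith) hYw.le)
    have h2 : Y ≤ max z Y := le_max_right _ _
    rw [h1]
    refine (riesz_mul_log_le hm (z := max z Y) (by linarith) (max_le hzw hYw.le) hwx.le ?_).trans ?_
    · refine hY.trans ?_
      gcongr
    · refine mul_le_mul (hanti (le_max_left _ _)) ?_ (Real.log_nonneg (by linarith))
        (riesz_nonneg _ _)
      rcases max_choice z Y with h | h <;> rw [h]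
      · exact le_max_left _ _
      · exact le_max_right _ _

theorem rieszLog_zero_le (m : ℕ) {x : ℝ} (hx0 : 0 < x) (hx : 1 ≤ Real.log x) :
    rieszLog m x 0 ≤ Real.log x := by
  rw [rieszLog, Real.log_zero, max_eq_right (log_div_log_nonneg hx0 hx), zero_div]
  refine (mul_le_of_le_one_left (log_div_log_nonneg hx0 hx) (riesz_le_one m le_rfl)).trans ?_
  refine Real.log_le_log (by have := one_le_div_log hx0 hx; linarith) ?_
  exact div_le_self hx0.le hx

theorem thetaRiesz_le_sum_rieszLog (m k : ℕ) {x : ℝ} (hx0 : 0 < x) (hx : 1 ≤ Real.log x) :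
    thetaRiesz m (x / 2 ^ k) * (1 + k * Real.log 2 / Real.log x) ≤
      ∑ p ∈ Finset.Ioc 0 ⌊x / 2 ^ k⌋₊ with p.Prime, rieszLog m x (2 ^ k * p) := by
  have hT : 0 < Real.log x := by linarith
  rw [thetaRiesz, Finset.sum_mul]
  refine Finset.sum_le_sum fun p hp ↦ ?_
  simp only [Finset.mem_filter, Finset.mem_Ioc] at hp
  have hp0 : (0 : ℝ) < p := by exact_mod_cast hp.2.pos
  have hp1 : (1 : ℝ) ≤ p := by exact_mod_cast hp.2.one_lt.le
  have hpx : (p : ℝ) ≤ x := by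
    refine ((Nat.le_floor_iff (by positivity)).1 hp.1.2).trans (div_le_self hx0.le ?_)
    exact one_le_pow₀ (by norm_num)
  have e : (2 : ℝ) ^ k * p / x = p / (x / 2 ^ k) := by field_simp
  rw [rieszLog, e]
  have h1 : Real.log p * (1 + k * Real.log 2 / Real.log x) ≤ Real.log (2 ^ k * p) := by
    rw [Real.log_mul (by positivity) hp0.ne', Real.log_pow]
    have h2 : Real.log p / Real.log x ≤ 1 := (div_le_one hT).2 (Real.log_le_log hp0 hpx)
    have h3 : 0 ≤ (k : ℝ) * Real.log 2 := by positivity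
    calc Real.log p * (1 + k * Real.log 2 / Real.log x)
        = Real.log p + k * Real.log 2 * (Real.log p / Real.log x) := by ring
      _ ≤ Real.log p + k * Real.log 2 * 1 := by gcongr
      _ = _ := by ring
  calc _ = riesz m (p / (x / 2 ^ k)) * (Real.log p * (1 + k * Real.log 2 / Real.log x)) := by ring
    _ ≤ _ := by
      gcongr
      · exact riesz_nonneg _ _
      · exact h1.trans (le_max_left _ _)

theorem sum_rieszLog_prime_le (m : ℕ) {x : ℝ} (hx0 : 0 < x) (hx : 1 ≤ Real.log x) :
    ∑ p ∈ Finset.Ioc 0 ⌊x⌋₊ with p.Prime, rieszLog m x p ≤ thetaRiesz m x +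
      ∑ p ∈ Finset.Ioc 0 ⌊x / Real.log x⌋₊ with p.Prime, Real.log (x / Real.log x / p) := by
  have hT : 0 < Real.log x := by linarith
  set Y := x / Real.log x with hY
  have hY1 : 1 ≤ Y := one_le_div_log hx0 hx
  have hYx : ⌊Y⌋₊ ≤ ⌊x⌋₊ := Nat.floor_le_floor (div_le_self hx0.le hx)
  have h1 : ∑ p ∈ Finset.Ioc 0 ⌊Y⌋₊ with p.Prime, Real.log (Y / p) =
      ∑ p ∈ Finset.Ioc 0 ⌊x⌋₊ with p.Prime, if p ≤ ⌊Y⌋₊ then Real.log (Y / p) else 0 := by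
    rw [← Finset.sum_filter]
    refine Finset.sum_congr ?_ fun _ _ ↦ rfl
    ext p
    simp only [Finset.mem_filter, Finset.mem_Ioc]
    constructor
    · rintro ⟨⟨a, b⟩, c⟩
      exact ⟨⟨⟨a, b.trans hYx⟩, c⟩, b⟩
    · rintro ⟨⟨⟨a, b⟩, c⟩, d⟩
      exact ⟨⟨a, d⟩, c⟩
  rw [h1, thetaRiesz, ← Finset.sum_add_distrib]
  refine Finset.sum_le_sum fun p hp ↦ ?_
  simp only [Finset.mem_filter, Finset.mem_Ioc] at hp
  have hp0 : (0 : ℝ) < p := by exact_mod_cast hp.2.pos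
  rw [rieszLog, ← hY]
  split_ifs with hpY
  · have h2 : (p : ℝ) ≤ Y := (Nat.le_floor_iff (by linarith)).1 hpY
    have h3 : Real.log p ≤ Real.log Y := Real.log_le_log hp0 h2
    rw [max_eq_right h3, Real.log_div (by linarith) hp0.ne']
    have h4 := riesz_le_one m (show 0 ≤ (p : ℝ) / x by positivity)
    nlinarith
  · have h2 : Y < p := by
      by_contra! h
      exact hpY (Nat.le_floor h)
    rw [max_eq_left (Real.log_le_log (by linarith) h2.le)]
    linarith

end RieszMeans

section TwoPowMulPrimes

open Filter Topology

theorem sum_mul_le_of_antitone {g f : ℕ → ℝ} (hf : Antitone f) {B : ℝ} {N : ℕ}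
    (hB : ∀ n < N, ∑ i ∈ Finset.range (n + 1), g i ≤ B) :
    ∑ i ∈ Finset.range N, g i * f i ≤ B * (f 0 - f N) + (∑ i ∈ Finset.range N, g i) * f N := by
  induction N with
  | zero => simp
  | succ n ih =>
    have h1 := ih fun k hk ↦ hB k (by omega)
    have h2 := hB n (by omega)
    have h3 : f (n + 1) ≤ f n := hf (by omega)
    rw [Finset.sum_range_succ] at h2 ⊢
    rw [Finset.sum_range_succ g]
    nlinarith

/-- The numbers up to `n` which are `2 ^ k` times a prime. -/
noncomputable def twoPowMulPrimes (k n : ℕ) : Finset ℕ :=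
  open Classical in {j ∈ Finset.range (n + 1) | ∃ p : ℕ, p.Prime ∧ j = 2 ^ k * p}

theorem mem_twoPowMulPrimes {k n j : ℕ} :
    j ∈ twoPowMulPrimes k n ↔ j ≤ n ∧ ∃ p : ℕ, p.Prime ∧ j = 2 ^ k * p := by
  classical
  simp [twoPowMulPrimes]

open Classical in
theorem sum_indicator_eq_card_twoPowMulPrimes (k n : ℕ) :
    ∑ i ∈ Finset.range (n + 1), (if ∃ p : ℕ, p.Prime ∧ i = 2 ^ k * p then (1 : ℝ) else 0) =
      (twoPowMulPrimes k n).card := by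
  rw [twoPowMulPrimes, Finset.sum_boole]

open Classical in
theorem sum_indicator_mul_eq (k : ℕ) {x : ℝ} (hx : 0 ≤ x) (f : ℝ → ℝ) :
    ∑ i ∈ Finset.range (⌊x⌋₊ + 1),
      (if ∃ p : ℕ, p.Prime ∧ i = 2 ^ k * p then (1 : ℝ) else 0) * f i =
      ∑ p ∈ Finset.Ioc 0 ⌊x / 2 ^ k⌋₊ with p.Prime, f (2 ^ k * p) := by
  simp only [ite_mul, one_mul, zero_mul]
  rw [← Finset.sum_filter]
  have h2 : (0 : ℝ) < 2 ^ k := by positivity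
  symm
  refine Finset.sum_bij (fun p _ ↦ 2 ^ k * p) ?_ ?_ ?_ ?_
  · intro p hp
    simp only [Finset.mem_filter, Finset.mem_Ioc, Finset.mem_range] at hp ⊢
    refine ⟨Nat.lt_succ_of_le (Nat.le_floor ?_), p, hp.2, rfl⟩
    have := (Nat.le_floor_iff (by positivity)).1 hp.1.2
    rw [le_div_iff₀ h2] at this
    push_cast
    linarith
  · intro p _ q _ h
    exact Nat.eq_of_mul_eq_mul_left (by positivity) h
  · intro j hj
    simp only [Finset.mem_filter, Finset.mem_range] at hj
    obtain ⟨hj, p, hp, rfl⟩ := hj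
    refine ⟨p, ?_, rfl⟩
    simp only [Finset.mem_filter, Finset.mem_Ioc]
    refine ⟨⟨hp.pos, Nat.le_floor ?_⟩, hp⟩
    have := (Nat.le_floor_iff hx).1 (Nat.lt_succ_iff.1 hj)
    push_cast at this
    rw [le_div_iff₀ h2]
    linarith
  · intro p _
    push_cast
    rfl

/-- If the counting functions of `2 ^ k * p`, `1 ≤ k ≤ K`, never exceed that of the primes by more
than `B`, the same holds for the weighted sums, up to the size of the weight. -/
theorem sum_rieszLog_sub_le {m : ℕ} (hm : 2 ≤ m) {x : ℝ} (hx0 : 0 < x) (hx : 1 ≤ Real.log x)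
    (K : ℕ) {B : ℝ} (hB0 : 0 ≤ B)
    (hB : ∀ n ≤ ⌊x⌋₊, ∑ k ∈ Finset.Icc 1 K, ((twoPowMulPrimes k n).card : ℝ) -
      (twoPowMulPrimes 0 n).card ≤ B) :
    ∑ k ∈ Finset.Icc 1 K, ∑ p ∈ Finset.Ioc 0 ⌊x / 2 ^ k⌋₊ with p.Prime, rieszLog m x (2 ^ k * p) -
      ∑ p ∈ Finset.Ioc 0 ⌊x⌋₊ with p.Prime, rieszLog m x p ≤ B * Real.log x := by
  classical
  set a : ℕ → ℕ → ℝ := fun k i ↦ if ∃ p : ℕ, p.Prime ∧ i = 2 ^ k * p then (1 : ℝ) else 0 with ha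
  set g : ℕ → ℝ := fun i ↦ ∑ k ∈ Finset.Icc 1 K, a k i - a 0 i with hg
  have hsum : ∀ n, ∑ i ∈ Finset.range (n + 1), g i =
      ∑ k ∈ Finset.Icc 1 K, ((twoPowMulPrimes k n).card : ℝ) - (twoPowMulPrimes 0 n).card := by
    intro n
    simp only [hg, Finset.sum_sub_distrib, ← sum_indicator_eq_card_twoPowMulPrimes]
    rw [Finset.sum_comm]
  have hf : Antitone fun i : ℕ ↦ rieszLog m x i := fun i j hij ↦
    rieszLog_antitoneOn hm hx0 hx (Set.mem_Ici.2 i.cast_nonneg) (Set.mem_Ici.2 j.cast_nonneg)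
      (by exact_mod_cast hij)
  have h1 := sum_mul_le_of_antitone (g := g) hf (B := B) (N := ⌊x⌋₊ + 1) fun n hn ↦ by
    rw [hsum]
    exact hB n (by omega)
  have h2 : ∑ i ∈ Finset.range (⌊x⌋₊ + 1), g i * rieszLog m x i =
      ∑ k ∈ Finset.Icc 1 K, ∑ p ∈ Finset.Ioc 0 ⌊x / 2 ^ k⌋₊ with p.Prime,
        rieszLog m x (2 ^ k * p) - ∑ p ∈ Finset.Ioc 0 ⌊x⌋₊ with p.Prime, rieszLog m x p := by
    simp only [hg, sub_mul, Finset.sum_sub_distrib, Finset.sum_mul]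
    rw [Finset.sum_comm]
    have e1 : ∀ k, ∑ i ∈ Finset.range (⌊x⌋₊ + 1), a k i * rieszLog m x i = _ := fun k ↦
      sum_indicator_mul_eq k hx0.le (rieszLog m x)
    simp only [e1, pow_zero, div_one, one_mul]
  rw [h2] at h1
  refine h1.trans ?_
  have h3 := rieszLog_nonneg m hx0 hx ((⌊x⌋₊ + 1 : ℕ) : ℝ)
  have h4 := rieszLog_zero_le m hx0 hx
  have h5 := hB ⌊x⌋₊ le_rfl
  rw [← hsum] at h5
  calc _ ≤ B * (rieszLog m x (0 : ℕ) - rieszLog m x ((⌊x⌋₊ + 1 : ℕ) : ℝ)) +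
        B * rieszLog m x ((⌊x⌋₊ + 1 : ℕ) : ℝ) := by gcongr
    _ = B * rieszLog m x 0 := by
      rw [Nat.cast_zero]
      ring
    _ ≤ _ := by gcongr

theorem sum_two_pow_inv (K : ℕ) : ∑ k ∈ Finset.Icc 1 K, (1 / 2 ^ k : ℝ) = 1 - 1 / 2 ^ K := by
  induction K with
  | zero => simp
  | succ n ih =>
    rw [Finset.sum_Icc_succ_top (by omega), ih]
    field_simp
    ring

theorem le_sum_mul_two_pow_inv {K : ℕ} (hK : 5 ≤ K) :
    57 / 32 ≤ ∑ k ∈ Finset.Icc 1 K, ((k : ℝ) * (1 / 2 ^ k)) := by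
  calc (57 / 32 : ℝ) = ∑ k ∈ Finset.Icc (1 : ℕ) 5, ((k : ℝ) * (1 / 2 ^ k)) := by
        simp [Finset.sum_Icc_succ_top]
        norm_num
    _ ≤ _ := Finset.sum_le_sum_of_subset_of_nonneg (Finset.Icc_subset_Icc_right hK)
        fun _ _ _ ↦ by positivity

theorem eventually_le_sum_thetaRiesz_sub {m : ℕ}
    (h : Tendsto (fun x : ℝ ↦ (thetaRiesz m x - x / (m + 1)) * Real.log x / x) atTop (𝓝 0)) :
    ∀ᶠ x : ℝ in atTop, ∀ K : ℕ, Real.log x ≤ 2 ^ K → 2 ^ K ≤ 2 * Real.log x →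
      1 / (10 * (m + 1)) * (x / Real.log x) ≤
        ∑ k ∈ Finset.Icc 1 K, thetaRiesz m (x / 2 ^ k) * (1 + k * Real.log 2 / Real.log x) -
        (thetaRiesz m x +
          ∑ p ∈ Finset.Ioc 0 ⌊x / Real.log x⌋₊ with p.Prime, Real.log (x / Real.log x / p)) := by
  set α : ℝ := 1 / (m + 1) with hα
  have hα0 : 0 < α := by positivity
  set ε : ℝ := α / 100 with hε
  have hε0 : 0 < ε := by positivity
  have hyt : Tendsto (fun x : ℝ ↦ x / Real.log x) atTop atTop := by
    have h1 : Tendsto (fun x : ℝ ↦ Real.log x / x) atTop (𝓝[>] 0) := by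
      refine tendsto_nhdsWithin_iff.2 ⟨?_, ?_⟩
      · simpa using Real.isLittleO_log_id_atTop.tendsto_div_nhds_zero
      · filter_upwards [eventually_gt_atTop 1] with x hx
        exact div_pos (Real.log_pos hx) (by linarith)
    exact h1.inv_tendsto_nhdsGT_zero.congr fun x ↦ by simp
  have h1 : ∀ᶠ y : ℝ in atTop, |thetaRiesz m y - α * y| ≤ ε * (y / Real.log y) := by
    filter_upwards [(tendsto_order.1 h.abs).2 ε (by simpa using hε0), eventually_gt_atTop 1]
      with y hy hy1
    have hl : 0 < Real.log y := Real.log_pos hy1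
    have hy0 : 0 < y := by linarith
    have e : thetaRiesz m y - α * y = thetaRiesz m y - y / (m + 1) := by rw [hα]; ring
    rw [e]
    rw [mul_div_assoc, abs_mul, abs_of_nonneg (show 0 ≤ Real.log y / y by positivity)] at hy
    have h2 : 0 ≤ y / Real.log y := by positivity
    calc _ = |thetaRiesz m y - y / (m + 1)| * (Real.log y / y) * (y / Real.log y) := by
          field_simp
      _ ≤ _ := by gcongr
  obtain ⟨Y₀, hY₀⟩ := eventually_atTop.1 h1
  filter_upwards [(hyt.eventually_ge_atTop (2 * max Y₀ 1)), hyt.eventually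
    (eventually_sum_log_div_prime_le hε0), Real.tendsto_log_atTop.eventually_ge_atTop 100,
    eventually_gt_atTop 1, hyt.eventually_ge_atTop 1] with x hxY hR hT hx1 hx2 K hK1 hK2
  have hx0 : 0 < x := by linarith
  set T := Real.log x with hTdef
  have hT0 : 0 < T := by linarith
  set X := x / T with hX
  have hX0 : 0 < X := by linarith
  have hK5 : 5 ≤ K := by
    by_contra! hK
    have : (2 : ℝ) ^ K ≤ 2 ^ 4 := pow_le_pow_right₀ (by norm_num) (by omega)
    linarith
  have hk : ∀ k ∈ Finset.Icc 1 K, (α - 2 * ε) * (x / 2 ^ k) ≤ thetaRiesz m (x / 2 ^ k) ∧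
      α * (x / 2 ^ k) - 2 * ε * (x / 2 ^ k / T) ≤ thetaRiesz m (x / 2 ^ k) := by
    intro k hk
    rw [Finset.mem_Icc] at hk
    set y := x / 2 ^ k with hy
    have h2k : (2 : ℝ) ^ k ≤ 2 * T := (pow_le_pow_right₀ (by norm_num) hk.2).trans hK2
    have hyX : X / 2 ≤ y := by
      rw [hX, hy, div_div]
      gcongr
      linarith
    have hyY : Y₀ ≤ y := by
      have := le_max_left Y₀ 1
      linarith
    have hy1 : 1 ≤ y := by
      have := le_max_right Y₀ 1
      linarith
    have hly : T / 2 ≤ Real.log y := by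
      have e1 : Real.log (2 ^ k) ≤ Real.log (2 * T) := Real.log_le_log (by positivity) h2k
      have e2 := Real.log_le_sub_one_of_pos (show 0 < T / 4 by positivity)
      rw [show T / 4 = 2 * T / 2 ^ 3 by ring, Real.log_div (by positivity) (by positivity),
        Real.log_pow] at e2
      have e3 := Real.log_two_lt_d9
      rw [hy, Real.log_div (by positivity) (by positivity)]
      push_cast at e2
      linarith
    have h3 := (abs_le.1 (hY₀ y hyY)).1
    have h4 : y / Real.log y ≤ 2 * (y / T) := by
      calc y / Real.log y ≤ y / (T / 2) := by gcongr
        _ = _ := by field_simp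
    have h5 : ε * (y / Real.log y) ≤ ε * (2 * (y / T)) := by gcongr
    have h6 : ε * (y / T) ≤ ε * y := by
      gcongr
      exact div_le_self (by linarith) (by linarith)
    constructor <;> nlinarith
  have hl2 := Real.log_two_gt_d9
  have hterm : ∀ k ∈ Finset.Icc 1 K, (α * x - 2 * ε * X) * (1 / 2 ^ k) +
      (α - 2 * ε) * X * Real.log 2 * (k * (1 / 2 ^ k)) ≤
      thetaRiesz m (x / 2 ^ k) * (1 + k * Real.log 2 / T) := by
    intro k hk'
    obtain ⟨a1, a2⟩ := hk k hk'
    have a3 : 0 ≤ k * Real.log 2 / T := by positivity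
    calc _ = (α * (x / 2 ^ k) - 2 * ε * (x / 2 ^ k / T)) +
          (α - 2 * ε) * (x / 2 ^ k) * (k * Real.log 2 / T) := by
          rw [hX]
          field_simp
      _ ≤ thetaRiesz m (x / 2 ^ k) + thetaRiesz m (x / 2 ^ k) * (k * Real.log 2 / T) := by
          gcongr
      _ = _ := by ring
  have hsum := Finset.sum_le_sum hterm
  rw [Finset.sum_add_distrib, ← Finset.mul_sum, ← Finset.mul_sum, sum_two_pow_inv] at hsum
  have hS := le_sum_mul_two_pow_inv hK5
  have hαε : 0 ≤ α - 2 * ε := by linarith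
  have hmain : (α - 2 * ε) * X * Real.log 2 * (57 / 32) ≤
      (α - 2 * ε) * X * Real.log 2 * ∑ k ∈ Finset.Icc 1 K, ((k : ℝ) * (1 / 2 ^ k)) := by
    gcongr
  have hlog : (α - 2 * ε) * X * 0.6931 * (57 / 32) ≤
      (α - 2 * ε) * X * Real.log 2 * (57 / 32) := by
    gcongr
    linarith
  have hpow : α * x * (1 / 2 ^ K) ≤ α * X := by
    rw [hX, mul_one_div, mul_div_assoc]
    gcongr
  have hpow' : 0 ≤ 2 * ε * X * (1 / 2 ^ K) := by positivity
  have hxx : Y₀ ≤ x := by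
    have b1 : X ≤ x := div_le_self hx0.le (by linarith)
    have b2 := le_max_left Y₀ 1
    have b3 := le_max_right Y₀ 1
    linarith
  have hΘ := (abs_le.1 (hY₀ x hxx)).2
  have hαX : 0 < α * X := by positivity
  have hc : 1 / (10 * ((m : ℝ) + 1)) * X = α * X / 10 := by
    rw [hα]
    field_simp
  rw [hc]
  have hεX : ε * X = α * X / 100 := by rw [hε]; ring
  linarith

/-- Somewhere below `x`, the numbers `2 ^ k * p` with `1 ≤ k ≤ K` outnumber the primes by
`≫ x / log ^ 2 x`, where `2 ^ K` has size about `log x`. -/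
theorem exists_le_sum_card_twoPowMulPrimes_sub :
    ∃ c : ℝ, 0 < c ∧ ∀ᶠ x : ℝ in atTop, ∀ K : ℕ, Real.log x ≤ 2 ^ K → 2 ^ K ≤ 2 * Real.log x →
      ∃ n ≤ ⌊x⌋₊, c * x / Real.log x ^ 2 ≤
        ∑ k ∈ Finset.Icc 1 K, ((twoPowMulPrimes k n).card : ℝ) - (twoPowMulPrimes 0 n).card := by
  obtain ⟨m, hm, h⟩ := exists_tendsto_thetaRiesz
  refine ⟨1 / (20 * (m + 1)), by positivity, ?_⟩
  filter_upwards [eventually_le_sum_thetaRiesz_sub h,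
    Real.tendsto_log_atTop.eventually_ge_atTop 1, eventually_gt_atTop 0] with x hx hx1 hx0 K hK1 hK2
  by_contra! hcon
  have hT0 : 0 < Real.log x := by linarith
  have h1 := sum_rieszLog_sub_le hm hx0 hx1 K (B := 1 / (20 * (m + 1)) * x / Real.log x ^ 2)
    (by positivity) fun n hn ↦ (hcon n hn).le
  have h2 := hx K hK1 hK2
  have h3 := sum_rieszLog_prime_le m hx0 hx1
  have h4 := Finset.sum_le_sum fun k (_ : k ∈ Finset.Icc 1 K) ↦
    thetaRiesz_le_sum_rieszLog m k hx0 hx1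
  have h5 : 1 / (20 * ((m : ℝ) + 1)) * x / Real.log x ^ 2 * Real.log x =
      1 / (10 * (m + 1)) * (x / Real.log x) / 2 := by
    field_simp
    norm_num
  have h6 : 0 < 1 / (10 * ((m : ℝ) + 1)) * (x / Real.log x) := by positivity
  linarith

end TwoPowMulPrimes

section Totient

open Filter Topology

theorem totient_two_pow_mul_prime {k p : ℕ} (hk : 1 ≤ k) (hp : p.Prime) (hp2 : p ≠ 2) :
    Nat.totient (2 ^ k * p) = 2 ^ (k - 1) * (p - 1) := by
  have hc : Nat.Coprime (2 ^ k) p :=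
    Nat.Coprime.pow_left _ ((Nat.coprime_primes Nat.prime_two hp).2 hp2.symm)
  rw [Nat.totient_mul hc, Nat.totient_prime hp, Nat.totient_prime_pow Nat.prime_two hk]
  simp

theorem two_pow_mul_sub_one_le {j p q : ℕ} (h : 2 ^ j * p ≤ q) :
    2 ^ j * (p - 1) ≤ q - 1 := by
  have : 1 ≤ 2 ^ j := Nat.one_le_two_pow
  rw [Nat.mul_sub, mul_one]
  omega

theorem sub_one_le_two_pow_mul {j p q : ℕ} (hp : 1 ≤ p) (hq : q.Prime)
    (hj : ¬ Nat.Prime ⌈(p : ℝ) / 2 ^ j⌉₊) (h : p ≤ 2 ^ j * q) :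
    p - 1 ≤ 2 ^ j * (q - 1) := by
  by_contra! hcon
  refine hj ?_
  have hc : ⌈(p : ℝ) / 2 ^ j⌉₊ = q := by
    rw [Nat.ceil_eq_iff hq.ne_zero, lt_div_iff₀ (by positivity), div_le_iff₀ (by positivity)]
    constructor
    · have : (q - 1) * 2 ^ j < p := by
        rw [mul_comm]
        omega
      exact_mod_cast this
    · rw [mul_comm] at h
      exact_mod_cast h
  rwa [hc]

theorem totient_two_pow_mul_prime_le {K k l p q : ℕ} (hk : k ∈ Finset.Icc 1 K)
    (hl : l ∈ Finset.Icc 1 K) (hp : p.Prime) (hp2 : p ≠ 2) (hq : q.Prime) (hq2 : q ≠ 2)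
    (hpK : ∀ j ∈ Finset.Icc 1 K, ¬ Nat.Prime ⌈(p : ℝ) / 2 ^ j⌉₊) (h : 2 ^ k * p ≤ 2 ^ l * q) :
    Nat.totient (2 ^ k * p) ≤ Nat.totient (2 ^ l * q) := by
  rw [Finset.mem_Icc] at hk hl
  rw [totient_two_pow_mul_prime hk.1 hp hp2, totient_two_pow_mul_prime hl.1 hq hq2]
  rcases le_or_gt l k with hlk | hkl
  · obtain ⟨j, rfl⟩ := Nat.exists_eq_add_of_le hlk
    rw [pow_add, mul_assoc] at h
    have h1 := two_pow_mul_sub_one_le (Nat.le_of_mul_le_mul_left h (by positivity))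
    rw [show l + j - 1 = l - 1 + j by omega, pow_add, mul_assoc]
    gcongr
  · obtain ⟨j, rfl⟩ := Nat.exists_eq_add_of_le hkl.le
    rw [pow_add, mul_assoc] at h
    have h1 := sub_one_le_two_pow_mul hp.one_le hq
      (hpK j (Finset.mem_Icc.2 (by omega))) (Nat.le_of_mul_le_mul_left h (by positivity))
    rw [show k + j - 1 = k - 1 + j by omega, pow_add, mul_assoc]
    gcongr

theorem two_pow_mul_prime_left_inj {k l p q : ℕ} (hp : p.Prime) (hp2 : p ≠ 2) (hq : q.Prime)
    (hq2 : q ≠ 2) (h : 2 ^ k * p = 2 ^ l * q) : k = l := by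
  have key : ∀ {k p : ℕ}, p.Prime → p ≠ 2 → (2 ^ k * p).factorization 2 = k := by
    intro k p hp hp2
    rw [Nat.factorization_mul (by positivity) hp.ne_zero, Nat.prime_two.factorization_pow,
      hp.factorization]
    simp [hp2]
  have h1 := key (k := k) hp hp2
  rw [h, key hq hq2] at h1
  exact h1.symm

theorem card_le_Mx {x : ℝ} {B : Finset ℕ} (hB : ∀ n ∈ B, 1 ≤ n ∧ (n : ℝ) ≤ x)
    (hφ : ∀ m ∈ B, ∀ n ∈ B, m ≤ n → Nat.totient m ≤ Nat.totient n) : B.card ≤ Mx x := by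
  refine le_csSup ⟨⌊x⌋₊ + 1, ?_⟩ ⟨B, fun n hn ↦ hB n hn, hφ, rfl⟩
  rintro _ ⟨A, hA, -, rfl⟩
  rw [← Finset.card_range (⌊x⌋₊ + 1)]
  exact Finset.card_le_card fun n hn ↦
    Finset.mem_range.2 (Nat.lt_succ_of_le (Nat.le_floor (hA hn).2))

theorem primePi_eq_card {x : ℝ} (hx : 0 ≤ x) :
    primePi x = (twoPowMulPrimes 0 ⌊x⌋₊).card := by
  rw [primePi, ← Set.ncard_coe_finset]
  congr 1
  ext p
  simp [mem_twoPowMulPrimes, Nat.le_floor_iff hx, and_comm]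

theorem sum_card_sub_le_Mx_sub_primePi {x : ℝ} (hx : 0 ≤ x) {n : ℕ} (hn : n ≤ ⌊x⌋₊) (K : ℕ) :
    ∑ k ∈ Finset.Icc 1 K, ((twoPowMulPrimes k n).card : ℝ) - (twoPowMulPrimes 0 n).card -
      K * (1 + ∑ j ∈ Finset.Icc 1 K,
        ({p : ℕ | p.Prime ∧ (p : ℝ) ≤ x ∧ Nat.Prime ⌈(p : ℝ) / 2 ^ j⌉₊}.ncard : ℝ)) ≤
      (Mx x : ℝ) - primePi x := by
  classical
  set S : ℕ → Set ℕ := fun j ↦ {p : ℕ | p.Prime ∧ (p : ℝ) ≤ x ∧ Nat.Prime ⌈(p : ℝ) / 2 ^ j⌉₊}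
    with hS
  have hfin : ∀ j, (S j).Finite := fun j ↦
    (Set.finite_Iic ⌊x⌋₊).subset fun p hp ↦ Nat.le_floor hp.2.1
  set E : Finset ℕ := insert 2 ((Finset.Icc 1 K).biUnion fun j ↦ (hfin j).toFinset) with hE
  have hEcard : E.card ≤ 1 + ∑ j ∈ Finset.Icc 1 K, (S j).ncard := by
    refine (Finset.card_insert_le _ _).trans ?_
    rw [add_comm]
    gcongr
    refine Finset.card_biUnion_le.trans (Finset.sum_le_sum fun j _ ↦ ?_)
    rw [Set.ncard_eq_toFinset_card _ (hfin j)]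
  set A : ℕ → Finset ℕ := fun k ↦ twoPowMulPrimes k n \ E.image (2 ^ k * ·) with hA
  have hAmem : ∀ {k j}, j ∈ A k → j ≤ n ∧ ∃ p : ℕ, p.Prime ∧ p ≠ 2 ∧
      (∀ i ∈ Finset.Icc 1 K, ¬ Nat.Prime ⌈(p : ℝ) / 2 ^ i⌉₊) ∧ j = 2 ^ k * p := by
    intro k j hj
    rw [hA, Finset.mem_sdiff, mem_twoPowMulPrimes] at hj
    obtain ⟨⟨hjn, p, hp, rfl⟩, hpE⟩ := hj
    have hpE' : p ∉ E := fun h ↦ hpE (Finset.mem_image_of_mem _ h)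
    refine ⟨hjn, p, hp, fun h ↦ hpE' (by simp [hE, h]), fun i hi hprime ↦ hpE' ?_, rfl⟩
    have hpx : (p : ℝ) ≤ x := (Nat.le_floor_iff hx).1
      ((Nat.le_mul_of_pos_left p (by positivity)).trans (hjn.trans hn))
    exact Finset.mem_insert_of_mem (Finset.mem_biUnion.2 ⟨i, hi, by simpa using ⟨hp, hpx, hprime⟩⟩)
  have hAcard : ∀ k, ((twoPowMulPrimes k n).card : ℝ) - E.card ≤ (A k).card := by
    intro k
    have h1 := Finset.le_card_sdiff (E.image (2 ^ k * ·)) (twoPowMulPrimes k n)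
    have h2 : (E.image (2 ^ k * ·)).card ≤ E.card := Finset.card_image_le
    have h3 : (twoPowMulPrimes k n).card ≤ (A k).card + E.card := by
      simp only [hA]
      omega
    rw [sub_le_iff_le_add]
    exact_mod_cast h3
  set P : Finset ℕ := twoPowMulPrimes 0 ⌊x⌋₊ \ twoPowMulPrimes 0 n with hP
  have hPmem : ∀ {q}, q ∈ P → n < q ∧ q ≤ ⌊x⌋₊ ∧ q.Prime := by
    intro q hq
    simp only [hP, Finset.mem_sdiff, mem_twoPowMulPrimes, pow_zero, one_mul, exists_eq_right',
      not_and] at hq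
    refine ⟨?_, hq.1⟩
    by_contra! hqn
    exact hq.2 hqn hq.1.2
  have hPcard : P.card + (twoPowMulPrimes 0 n).card = primePi x := by
    rw [primePi_eq_card hx]
    refine Finset.card_sdiff_add_card_eq_card fun q hq ↦ ?_
    rw [mem_twoPowMulPrimes] at hq ⊢
    exact ⟨hq.1.trans hn, hq.2⟩
  have hdisjA : Set.PairwiseDisjoint (Finset.Icc 1 K : Set ℕ) A := by
    intro k _ l _ hkl
    refine Finset.disjoint_left.2 fun j hj hj' ↦ hkl ?_
    obtain ⟨-, p, hp, hp2, -, rfl⟩ := hAmem hj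
    obtain ⟨-, q, hq, hq2, -, h⟩ := hAmem hj'
    exact two_pow_mul_prime_left_inj hp hp2 hq hq2 h
  have hdisj : Disjoint ((Finset.Icc 1 K).biUnion A) P := by
    refine Finset.disjoint_left.2 fun j hj hj' ↦ ?_
    obtain ⟨k, _, hj⟩ := Finset.mem_biUnion.1 hj
    have h1 := (hAmem hj).1
    have h2 := (hPmem hj').1
    omega
  have hM : ((Finset.Icc 1 K).biUnion A ∪ P).card ≤ Mx x := by
    refine card_le_Mx ?_ ?_
    · intro j hj
      rcases Finset.mem_union.1 hj with hj | hj
      · obtain ⟨k, _, hj⟩ := Finset.mem_biUnion.1 hj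
        obtain ⟨hjn, p, hp, -, -, rfl⟩ := hAmem hj
        exact ⟨Nat.mul_pos (by positivity) hp.pos, (Nat.le_floor_iff hx).1 (hjn.trans hn)⟩
      · obtain ⟨_, hjx, hj⟩ := hPmem hj
        exact ⟨hj.one_le, (Nat.le_floor_iff hx).1 hjx⟩
    · intro a ha b hb hab
      rcases Finset.mem_union.1 ha with ha | ha <;> rcases Finset.mem_union.1 hb with hb | hb
      · obtain ⟨k, hk, ha⟩ := Finset.mem_biUnion.1 ha
        obtain ⟨l, hl, hb⟩ := Finset.mem_biUnion.1 hb
        obtain ⟨-, p, hp, hp2, hpK, rfl⟩ := hAmem ha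
        obtain ⟨-, q, hq, hq2, -, rfl⟩ := hAmem hb
        exact totient_two_pow_mul_prime_le hk hl hp hp2 hq hq2 hpK hab
      · obtain ⟨k, _, ha⟩ := Finset.mem_biUnion.1 ha
        have h1 := (hAmem ha).1
        obtain ⟨h2, -, hq⟩ := hPmem hb
        have h3 := Nat.totient_le a
        rw [Nat.totient_prime hq]
        omega
      · obtain ⟨l, _, hb⟩ := Finset.mem_biUnion.1 hb
        have h1 := (hAmem hb).1
        have h2 := (hPmem ha).1
        omega
      · rw [Nat.totient_prime (hPmem ha).2.2, Nat.totient_prime (hPmem hb).2.2]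
        omega
  rw [Finset.card_union_of_disjoint hdisj, Finset.card_biUnion hdisjA] at hM
  have hM' : ∑ k ∈ Finset.Icc 1 K, ((A k).card : ℝ) + P.card ≤ Mx x := by exact_mod_cast hM
  have hP' : (P.card : ℝ) + (twoPowMulPrimes 0 n).card = primePi x := by exact_mod_cast hPcard
  have hE' : (E.card : ℝ) ≤ 1 + ∑ j ∈ Finset.Icc 1 K, ((S j).ncard : ℝ) := by
    exact_mod_cast hEcard
  have h1 := Finset.sum_le_sum fun k (_ : k ∈ Finset.Icc 1 K) ↦ hAcard k
  rw [Finset.sum_sub_distrib, Finset.sum_const, Nat.card_Icc, nsmul_eq_mul] at h1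
  have h2 : (K : ℝ) * E.card ≤ K * (1 + ∑ j ∈ Finset.Icc 1 K, ((S j).ncard : ℝ)) := by gcongr
  simp only [Nat.add_sub_cancel] at h1
  linarith

end Totient

theorem stmt12
    (h : ∃ C : ℝ, 0 < C ∧ ∃ x₀ : ℝ, ∀ x : ℝ, x₀ ≤ x → ∀ k : ℕ, 1 ≤ k →
      (2 : ℝ) ^ k ≤ 2 * Real.log x →
      ({p : ℕ | p.Prime ∧ (p : ℝ) ≤ x ∧ Nat.Prime ⌈(p : ℝ) / 2 ^ k⌉₊}.ncard : ℝ) ≤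
        C * x / ((Real.log x) ^ 2 * (Real.log (Real.log x)) ^ 3)) :
    ∃ c : ℝ, 0 < c ∧ ∃ x₁ : ℝ, ∀ x : ℝ, x₁ ≤ x →
      c * x / (Real.log x) ^ 2 ≤ (Mx x : ℝ) - (primePi x : ℝ) := by
  obtain ⟨C, hC, x₀, h⟩ := h
  obtain ⟨c, hc, hn⟩ := exists_le_sum_card_twoPowMulPrimes_sub
  refine ⟨c / 2, by positivity, Filter.eventually_atTop.1 ?_⟩
  have hpow := (Real.isLittleO_pow_log_id_atTop (n := 3)).bound (show 0 < c / 12 by positivity)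
  filter_upwards [hn, hpow, Filter.eventually_ge_atTop x₀, Filter.eventually_gt_atTop 0,
    Real.tendsto_log_atTop.eventually_ge_atTop 1,
    (Real.tendsto_log_atTop.comp Real.tendsto_log_atTop).eventually_ge_atTop
      (max 1 (36 * C / c))] with x hn hpow hx₀ hx0 hT hL
  simp only [Function.comp_apply, max_le_iff, div_le_iff₀ hc] at hL
  set T := Real.log x
  set L := Real.log T
  obtain ⟨hL1, hLC⟩ := hL
  have hT0 : 0 < T := by linarith
  have hL0 : 0 < L := by linarith
  have hxpow : T ^ 3 ≤ c / 12 * x := by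
    simpa [abs_of_pos hT0, abs_of_pos hx0] using hpow
  obtain ⟨i, hi1, hi2⟩ := exists_nat_pow_near hT one_lt_two
  set K := i + 1
  have hK2 : (2 : ℝ) ^ K ≤ 2 * T := by
    rw [pow_succ]
    linarith
  obtain ⟨n, hnx, hn⟩ := hn K hi2.le hK2
  refine le_trans ?_ (sum_card_sub_le_Mx_sub_primePi hx0.le hnx K)
  have hKL : (K : ℝ) ≤ 3 * L := by
    have h1 := Real.log_le_log (by positivity) hi1
    rw [Real.log_pow] at h1
    have h2 := Real.log_two_gt_d9
    have h3 : (i : ℝ) * 0.5 ≤ i * Real.log 2 := by gcongr; linarith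
    simp only [K]
    push_cast
    linarith
  have hS : ∑ j ∈ Finset.Icc 1 K,
      ({p : ℕ | p.Prime ∧ (p : ℝ) ≤ x ∧ Nat.Prime ⌈(p : ℝ) / 2 ^ j⌉₊}.ncard : ℝ) ≤
      K * (C * x / (T ^ 2 * L ^ 3)) := by
    refine (Finset.sum_le_card_nsmul _ _ (C * x / (T ^ 2 * L ^ 3)) fun j hj ↦ ?_).trans_eq
      (by simp)
    rw [Finset.mem_Icc] at hj
    exact h x hx₀ j hj.1 ((pow_le_pow_right₀ one_le_two hj.2).trans hK2)
  have hloss : (K : ℝ) * (1 + K * (C * x / (T ^ 2 * L ^ 3))) ≤ c / 2 * x / T ^ 2 := by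
    calc (K : ℝ) * (1 + K * (C * x / (T ^ 2 * L ^ 3)))
        ≤ (3 * L) * (1 + 3 * L * (C * x / (T ^ 2 * L ^ 3))) := by gcongr
      _ = 3 * L + 9 * C / L * (x / T ^ 2) := by
        field_simp
        ring
      _ ≤ c / 4 * (x / T ^ 2) + c / 4 * (x / T ^ 2) := by
        refine add_le_add ?_ (mul_le_mul_of_nonneg_right ?_ (by positivity))
        · have hLT : L ≤ T := by linarith [Real.log_le_sub_one_of_pos hT0]
          rw [← mul_div_assoc, le_div_iff₀ (by positivity)]
          calc 3 * L * T ^ 2 ≤ 3 * T * T ^ 2 := by gcongr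
            _ = 3 * T ^ 3 := by ring
            _ ≤ _ := by linarith
        · rw [div_le_iff₀ hL0]
          linarith
      _ = _ := by ring
  have hloss' := mul_le_mul_of_nonneg_left (add_le_add_right hS 1) (Nat.cast_nonneg (α := ℝ) K)
  have e : c * x / T ^ 2 = c / 2 * x / T ^ 2 + c / 2 * x / T ^ 2 := by ring
  linarith
end

section
/- Let p and p' be odd primes and k, k' natural numbers with k, k' ≥ 1. If 2^k·p < 2^{k'}·p' and φ(2^k·p) > φ(2^{k'}·p'), then k' > k and p' = ⌈p/2^{k'−k}⌉. -/
open scoped BigOperators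

theorem two_mul_totient_two_pow_mul_prime {p k : ℕ} (hp : p.Prime) (hodd : Odd p)
    (hk : 1 ≤ k) : 2 * Nat.totient (2 ^ k * p) = 2 ^ k * (p - 1) := by
  have hcop : Nat.Coprime (2 ^ k) p := (Nat.coprime_two_left.mpr hodd).pow_left k
  obtain ⟨m, rfl⟩ := Nat.exists_eq_add_of_le' hk
  rw [Nat.totient_mul hcop, Nat.totient_prime hp, Nat.totient_prime_pow_succ Nat.prime_two]
  ring

theorem stmt13 (p p' k k' : ℕ) (hp : p.Prime) (hp' : p'.Prime)
    (hpodd : Odd p) (hpodd' : Odd p') (hk : 1 ≤ k) (hk' : 1 ≤ k')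
    (hlt : 2 ^ k * p < 2 ^ k' * p')
    (hphi : Nat.totient (2 ^ k' * p') < Nat.totient (2 ^ k * p)) :
    k < k' ∧ p' = ⌈(p : ℝ) / 2 ^ (k' - k)⌉₊ := by
  have hmul : 2 ^ k' * (p' - 1) < 2 ^ k * (p - 1) := by
    rw [← two_mul_totient_two_pow_mul_prime hp hpodd hk,
      ← two_mul_totient_two_pow_mul_prime hp' hpodd' hk']
    omega
  have hkk : k < k' := by
    by_contra! h
    have hpow : 2 ^ k' ≤ 2 ^ k := Nat.pow_le_pow_right two_pos h
    rw [Nat.mul_sub_one, Nat.mul_sub_one] at hmul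
    have := Nat.le_mul_of_pos_right (2 ^ k) hp.pos
    omega
  refine ⟨hkk, ?_⟩
  obtain ⟨d, rfl⟩ := Nat.exists_eq_add_of_le hkk.le
  rw [pow_add, mul_assoc] at hlt hmul
  have hupper : p < 2 ^ d * p' := Nat.lt_of_mul_lt_mul_left hlt
  have hlower : 2 ^ d * (p' - 1) < p :=
    (Nat.lt_of_mul_lt_mul_left hmul).trans_le (Nat.sub_le p 1)
  rw [Nat.add_sub_cancel_left, eq_comm, Nat.ceil_eq_iff hp'.ne_zero,
    lt_div_iff₀' (by positivity), div_le_iff₀' (by positivity)]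
  exact ⟨by exact_mod_cast hlower, by exact_mod_cast hupper.le⟩
end

section
/- For every positive rational number q, one has ∑_{d : σ(d)/d = q} 1/d ≤ 1, where the sum ranges over all natural numbers d ≥ 1 with σ(d)/d = q. -/
open scoped BigOperators ENNReal

/-- The sum-of-divisors function `σ(n) = ∑_{d ∣ n} d`. -/
def sigma1 (n : ℕ) : ℕ := ∑ d ∈ n.divisors, d

theorem sigma1_mul_of_coprime {m n : ℕ} (h : m.Coprime n) :
    sigma1 (m * n) = sigma1 m * sigma1 n := by
  simpa [sigma1] using h.sum_divisors_mul

theorem sigma1_pos {n : ℕ} (hn : 0 < n) : 0 < sigma1 n :=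
  Finset.sum_pos (fun _ hd => Nat.pos_of_mem_divisors hd) ⟨n, Nat.mem_divisors_self n hn.ne'⟩

theorem lt_sigma1 {n : ℕ} (hn : 1 < n) : n < sigma1 n := by
  have h := Finset.sum_le_sum_of_subset (f := fun d : ℕ => d)
    (show ({1, n} : Finset ℕ) ⊆ n.divisors by
      intro d hd
      rw [Finset.mem_insert, Finset.mem_singleton] at hd
      rcases hd with rfl | rfl <;> simp <;> omega)
  rw [Finset.sum_pair (by omega)] at h
  unfold sigma1
  omega

theorem not_dvd_sigma1_prime_pow {p : ℕ} (hp : p.Prime) (k : ℕ) : ¬ p ∣ sigma1 (p ^ k) := by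
  intro h
  rw [sigma1, Nat.sum_divisors_prime_pow hp, Finset.sum_range_succ'] at h
  have h' : p ∣ ∑ i ∈ Finset.range k, p ^ (i + 1) :=
    Finset.dvd_sum fun i _ => dvd_pow_self p (Nat.succ_ne_zero i)
  exact hp.one_lt.ne' (Nat.dvd_one.mp (by simpa using (Nat.dvd_add_right h').mp h))

/-- The positive integers below `N` of abundancy index `q` all of whose prime factors
exceed `n`. -/
noncomputable def roughAbundancy (n N : ℕ) (q : ℚ) : Finset ℕ :=
  open Classical in
  (Finset.range N).filter fun d =>
    0 < d ∧ (∀ r : ℕ, r.Prime → r ∣ d → n < r) ∧ (sigma1 d : ℚ) / d = q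

theorem mem_roughAbundancy {n N : ℕ} {q : ℚ} {d : ℕ} :
    d ∈ roughAbundancy n N q ↔
      d < N ∧ 0 < d ∧ (∀ r : ℕ, r.Prime → r ∣ d → n < r) ∧ (sigma1 d : ℚ) / d = q := by
  simp [roughAbundancy]

theorem sum_Icc_inv_pow_le {p : ℕ} (hp : 2 ≤ p) (N : ℕ) :
    ∑ k ∈ Finset.Icc 1 N, (1 : ℝ) / (p : ℝ) ^ k ≤ 1 / ((p : ℝ) - 1) := by
  have hp' : (2 : ℝ) ≤ p := by exact_mod_cast hp
  have h1 : (0 : ℝ) < (p : ℝ) - 1 := by linarith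
  have key : ∑ k ∈ Finset.Icc 1 N, (1 : ℝ) / (p : ℝ) ^ k
      = 1 / ((p : ℝ) - 1) - 1 / (((p : ℝ) - 1) * (p : ℝ) ^ N) := by
    induction N with
    | zero => simp
    | succ N ih =>
      rw [Finset.sum_Icc_succ_top (by omega), ih]
      have : (p : ℝ) ≠ 0 := by positivity
      field_simp
      ring
  rw [key]
  have : 0 < 1 / (((p : ℝ) - 1) * (p : ℝ) ^ N) := by positivity
  linarith

theorem sum_Ioc_inv_mul_pred_le {n : ℕ} (hn : 1 ≤ n) (N : ℕ) :
    ∑ m ∈ Finset.Ioc n N, (1 : ℝ) / m * (1 / ((m : ℝ) - 1)) ≤ 1 / n := by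
  have hn' : (1 : ℝ) ≤ n := by exact_mod_cast hn
  rcases le_total N n with h | h
  · rw [Finset.Ioc_eq_empty_of_le h]
    simp
  · have key : ∑ m ∈ Finset.Ioc n N, (1 : ℝ) / m * (1 / ((m : ℝ) - 1)) = 1 / n - 1 / N := by
      induction N, h using Nat.le_induction with
      | base => simp
      | succ N hN ih =>
        have : (1 : ℝ) ≤ N := by exact_mod_cast hn.trans hN
        rw [Finset.sum_Ioc_succ_top hN, ih]
        push_cast
        have h1 : (N : ℝ) ≠ 0 := by positivity
        have h2 : (N : ℝ) + 1 ≠ 0 := by positivity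
        rw [add_sub_cancel_right]
        field_simp
        ring
    rw [key]
    have : (0 : ℝ) ≤ 1 / N := by positivity
    linarith

/-- Removing the full power of `p` from multiples of `p` of abundancy index `q`. -/
theorem sum_inv_le_of_prime_dvd {p : ℕ} (hp : p.Prime) {t N : ℕ} {q : ℚ} {B : ℝ} (hB : 0 ≤ B)
    {E : Finset ℕ}
    (hE : ∀ d ∈ E, d ≤ N ∧ 0 < d ∧ p ∣ d ∧ (∀ r : ℕ, r.Prime → r ∣ d → r ≠ p → t < r) ∧
      (sigma1 d : ℚ) / d = q)
    (h : ∀ k, 1 ≤ k → ∑ d ∈ roughAbundancy t N (q * p ^ k / sigma1 (p ^ k)), (1 : ℝ) / d ≤ B) :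
    ∑ d ∈ E, (1 : ℝ) / d ≤ B * (1 / ((p : ℝ) - 1)) := by
  have hmaps : ∀ d ∈ E, d.factorization p ∈ Finset.Icc 1 N := by
    intro d hd
    obtain ⟨hdN, hd0, hpd, -⟩ := hE d hd
    rw [Finset.mem_Icc]
    exact ⟨hp.factorization_pos_of_dvd hd0.ne' hpd,
      (Nat.factorization_lt p hd0.ne').le.trans hdN⟩
  rw [← Finset.sum_fiberwise_of_maps_to hmaps]
  have hfib : ∀ k ∈ Finset.Icc 1 N,
      ∑ d ∈ E with d.factorization p = k, (1 : ℝ) / d ≤ B * (1 / (p : ℝ) ^ k) := by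
    intro k hk
    have hk1 := (Finset.mem_Icc.mp hk).1
    have hpk : 0 < p ^ k := pow_pos hp.pos k
    have hdvd : ∀ d ∈ E.filter (fun d => d.factorization p = k), p ^ k * (d / p ^ k) = d := by
      intro d hd
      have := (Finset.mem_filter.mp hd).2
      rw [← this]
      exact Nat.ordProj_mul_ordCompl_eq_self d p
    have hinj : Set.InjOn (fun d => d / p ^ k) (E.filter (fun d => d.factorization p = k)) := by
      intro a ha b hb hab
      rw [← hdvd a ha, ← hdvd b hb]
      exact congrArg (p ^ k * ·) hab
    calc ∑ d ∈ E with d.factorization p = k, (1 : ℝ) / d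
        = ∑ d ∈ E with d.factorization p = k,
            1 / (p : ℝ) ^ k * (1 / ((d / p ^ k : ℕ) : ℝ)) := by
          refine Finset.sum_congr rfl fun d hd => ?_
          conv_lhs => rw [← hdvd d hd]
          push_cast
          rw [one_div_mul_one_div]
      _ = 1 / (p : ℝ) ^ k *
            ∑ m ∈ (E.filter (fun d => d.factorization p = k)).image (fun d => d / p ^ k),
              (1 : ℝ) / m := by
          rw [← Finset.mul_sum, Finset.sum_image hinj]
      _ ≤ 1 / (p : ℝ) ^ k * B := by
          refine mul_le_mul_of_nonneg_left (le_trans ?_ (h k hk1)) (by positivity)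
          refine Finset.sum_le_sum_of_subset_of_nonneg ?_ fun _ _ _ => by positivity
          intro m hm
          obtain ⟨d, hd, rfl⟩ := Finset.mem_image.mp hm
          have hdm := hdvd d hd
          obtain ⟨hdE, hdk⟩ := Finset.mem_filter.mp hd
          obtain ⟨hdN, hd0, hpd, hr, hq⟩ := hE d hdE
          have hm0 : 0 < d / p ^ k := by
            rcases Nat.eq_zero_or_pos (d / p ^ k) with h0 | h0
            · rw [h0] at hdm; omega
            · exact h0
          have hpm : ¬ p ∣ d / p ^ k := by
            rw [← hdk]; exact Nat.not_dvd_ordCompl hp hd0.ne'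
          have hcop : (p ^ k).Coprime (d / p ^ k) :=
            ((hp.coprime_iff_not_dvd).mpr hpm).pow_left k
          refine mem_roughAbundancy.mpr ⟨?_, hm0, ?_, ?_⟩
          · exact (Nat.div_lt_self hd0 (Nat.one_lt_pow (by omega) hp.one_lt)).trans_le hdN
          · intro r hrp hrm
            refine hr r hrp (hrm.trans ⟨p ^ k, by rw [mul_comm]; exact hdm.symm⟩) ?_
            rintro rfl
            exact hpm hrm
          · have hs := sigma1_mul_of_coprime hcop
            rw [hdm] at hs
            have h1 : (sigma1 (p ^ k) : ℚ) ≠ 0 := by exact_mod_cast (sigma1_pos hpk).ne'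
            have h2 : ((d / p ^ k : ℕ) : ℚ) ≠ 0 := by exact_mod_cast hm0.ne'
            have h3 : (p : ℚ) ^ k ≠ 0 := by exact_mod_cast hpk.ne'
            have h4 : (d : ℚ) = (p : ℚ) ^ k * ((d / p ^ k : ℕ) : ℚ) := by exact_mod_cast hdm.symm
            rw [← hq, hs, h4]
            push_cast
            field_simp
      _ = B * (1 / (p : ℝ) ^ k) := mul_comm _ _
  calc ∑ k ∈ Finset.Icc 1 N, ∑ d ∈ E with d.factorization p = k, (1 : ℝ) / d
      ≤ ∑ k ∈ Finset.Icc 1 N, B * (1 / (p : ℝ) ^ k) := Finset.sum_le_sum hfib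
    _ ≤ B * (1 / ((p : ℝ) - 1)) := by
        rw [← Finset.mul_sum]
        exact mul_le_mul_of_nonneg_left (sum_Icc_inv_pow_le hp.two_le N) hB

theorem sum_roughAbundancy_one_le (n N : ℕ) :
    ∑ d ∈ roughAbundancy n N 1, (1 : ℝ) / d ≤ 1 := by
  have hsub : roughAbundancy n N 1 ⊆ {1} := by
    intro d hd
    obtain ⟨-, hd0, -, hq⟩ := mem_roughAbundancy.mp hd
    rw [div_eq_one_iff_eq (by exact_mod_cast hd0.ne')] at hq
    have hq' : sigma1 d = d := by exact_mod_cast hq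
    rw [Finset.mem_singleton]
    by_contra hne
    have := lt_sigma1 (n := d) (by omega)
    omega
  refine (Finset.sum_le_sum_of_subset_of_nonneg hsub fun _ _ _ => by positivity).trans ?_
  simp

theorem sum_roughAbundancy_le {q : ℚ} (hq : q ≠ 1) {n : ℕ} (hn : 1 ≤ n) (N : ℕ) :
    ∑ d ∈ roughAbundancy n N q, (1 : ℝ) / d ≤ 1 / n := by
  induction N generalizing q n with
  | zero => simp [roughAbundancy]
  | succ N ih =>
    have hn' : (1 : ℝ) ≤ n := by exact_mod_cast hn
    by_cases hden : q.den = 1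
    · have hmin : ∀ d ∈ roughAbundancy n (N + 1) q,
          d.minFac.Prime ∧ d.minFac ∈ Finset.Ioc n N := by
        intro d hd
        obtain ⟨hdN, hd0, hr, hdq⟩ := mem_roughAbundancy.mp hd
        have hd1 : d ≠ 1 := by
          rintro rfl
          exact hq (by rw [← hdq]; simp [sigma1])
        refine ⟨Nat.minFac_prime hd1, Finset.mem_Ioc.mpr
          ⟨hr _ (Nat.minFac_prime hd1) d.minFac_dvd, ?_⟩⟩
        exact (Nat.minFac_le hd0).trans (by omega)
      rw [← Finset.sum_fiberwise_of_maps_to fun d hd => (hmin d hd).2]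
      refine (Finset.sum_le_sum fun p hp => ?_).trans (sum_Ioc_inv_mul_pred_le hn N)
      have hnp := (Finset.mem_Ioc.mp hp).1
      have hp1 : (1 : ℝ) < p := by exact_mod_cast (show 1 < p by omega)
      by_cases hpp : p.Prime
      · refine sum_inv_le_of_prime_dvd (q := q) (t := p) (N := N) hpp (by positivity) ?_ ?_
        · intro d hd
          obtain ⟨hd, hdp⟩ := Finset.mem_filter.mp hd
          obtain ⟨hdN, hd0, hr, hdq⟩ := mem_roughAbundancy.mp hd
          refine ⟨by omega, hd0, hdp ▸ d.minFac_dvd, fun r hr hrd hne => ?_, hdq⟩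
          have := Nat.minFac_le_of_dvd hr.two_le hrd
          omega
        · intro k hk
          refine ih ?_ (by omega)
          intro h
          have hs : (sigma1 (p ^ k) : ℚ) ≠ 0 := by
            exact_mod_cast (sigma1_pos (pow_pos hpp.pos k)).ne'
          rw [div_eq_one_iff_eq hs, ← (Rat.den_eq_one_iff q).mp hden] at h
          have h' : q.num * (p : ℤ) ^ k = sigma1 (p ^ k) := by exact_mod_cast h
          refine not_dvd_sigma1_prime_pow hpp k ?_
          have : (p : ℤ) ∣ sigma1 (p ^ k) := by
            rw [← h']
            exact (dvd_pow_self _ (by omega)).mul_left _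
          exact_mod_cast this
      · rw [Finset.sum_eq_zero]
        · have : 0 < (p : ℝ) - 1 := by linarith
          positivity
        · intro d hd
          obtain ⟨hd, hdp⟩ := Finset.mem_filter.mp hd
          exact absurd (hdp ▸ (hmin d hd).1) hpp
    · obtain ⟨p, hp, hpq⟩ := Nat.exists_prime_and_dvd hden
      have hdvd : ∀ d ∈ roughAbundancy n (N + 1) q, p ∣ d := by
        intro d hd
        obtain ⟨-, -, -, hdq⟩ := mem_roughAbundancy.mp hd
        refine hpq.trans ?_
        have := Rat.den_dvd (sigma1 d) d
        rw [Rat.divInt_eq_div] at this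
        push_cast at this
        rw [hdq] at this
        exact_mod_cast this
      rcases (roughAbundancy n (N + 1) q).eq_empty_or_nonempty with he | ⟨e, he⟩
      · rw [he]
        simp
      have hnp : n < p := (mem_roughAbundancy.mp he).2.2.1 p hp (hdvd e he)
      have hnp' : (n : ℝ) + 1 ≤ p := by exact_mod_cast hnp
      have hle := sum_inv_le_of_prime_dvd (q := q) (t := n) (N := N) (B := 1) hp zero_le_one
        (E := roughAbundancy n (N + 1) q)
        (fun d hd => by
          obtain ⟨hdN, hd0, hr, hdq⟩ := mem_roughAbundancy.mp hd
          exact ⟨by omega, hd0, hdvd d hd, fun r h1 h2 _ => hr r h1 h2, hdq⟩)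
        (fun k _ => by
          rcases eq_or_ne (q * p ^ k / sigma1 (p ^ k)) 1 with h | h
          · rw [h]
            exact sum_roughAbundancy_one_le n N
          · refine (ih h hn).trans ?_
            rw [div_le_one (by linarith)]
            exact hn')
      rw [one_mul] at hle
      exact hle.trans (one_div_le_one_div_of_le (by linarith) (by linarith))

theorem stmt14 (q : ℚ) (hq : 0 < q) :
    ∑' d : {d : ℕ // 0 < d ∧ (sigma1 d : ℚ) / d = q}, (1 : ℝ≥0∞) / (d.1 : ℝ≥0∞) ≤ 1 := by
  rw [ENNReal.tsum_eq_iSup_sum]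
  refine iSup_le fun s => ?_
  have hterm : ∀ d ∈ s, (1 : ℝ≥0∞) / (d.1 : ℝ≥0∞) = ENNReal.ofReal (1 / (d.1 : ℝ)) := by
    intro d _
    rw [ENNReal.ofReal_div_of_pos (by exact_mod_cast d.2.1), ENNReal.ofReal_one,
      ENNReal.ofReal_natCast]
  rw [Finset.sum_congr rfl hterm, ← ENNReal.ofReal_sum_of_nonneg fun _ _ => by positivity,
    ENNReal.ofReal_le_one]
  obtain ⟨N, hN⟩ := (s.image Subtype.val).exists_nat_subset_range
  have hsub : s.image Subtype.val ⊆ roughAbundancy 1 N q := fun d hd => by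
    obtain ⟨e, -, rfl⟩ := Finset.mem_image.mp hd
    exact mem_roughAbundancy.mpr
      ⟨Finset.mem_range.mp (hN hd), e.2.1, fun r hr _ => hr.one_lt, e.2.2⟩
  rw [← Finset.sum_image (f := fun d : ℕ => (1 : ℝ) / d) Subtype.val_injective.injOn]
  refine (Finset.sum_le_sum_of_subset_of_nonneg hsub fun _ _ _ => by positivity).trans ?_
  rcases eq_or_ne q 1 with rfl | h
  · exact sum_roughAbundancy_one_le 1 N
  · simpa using sum_roughAbundancy_le h le_rfl N
end
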